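/- Let (X_n)_{n∈ℕ} be a sequence of random vectors in ℝ^d that converges mod-Gaussian in the Laplace sense on a multi-strip S_{a,b'} = {z ∈ ℂ^d : a^{(i)} < Re(z^{(i)}) < b'^{(i)} for all i}, with parameters t_n I_d and limiting function ψ, where ψ does not vanish on the real part of the multi-strip. Let b > 0 with the Euclidean sphere of radius b contained in the open hypercube ∏_{i=1}^d (a^{(i)}, b'^{(i)}). Let S ⊂ S^{d−1} be a Borel subset of the unit sphere, measurable by hypercubic facets and of non-zero surface measure, and let B = S × [b,+∞) := {r s : r ≥ b, s ∈ S} be the corresponding spherical sector. Then P[X_n ∈ t_n B] = (t_n/(2π))^{d/2} (1/(t_n b)) e^{−t_n b²/2} (∫_{S_b} ψ(s) μ_surface(ds)) (1 + o(1)) as n → ∞, where S_b = {b s : s ∈ S} and μ_surface is the Lebesgue surface measure on the sphere of radius b. -/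

import Mathlib

open MeasureTheory Filter
open scoped Topology ENNReal BigOperators Pointwise

noncomputable section

/-- The Lebesgue surface measure on the sphere of radius `b` in `ℝ^d`: for `A` contained in
the sphere, `μ_surface(A) = (d/b)·Leb({x : ‖x‖ ≤ b, (b/‖x‖)x ∈ A})`, the normalized cone
measure; its total mass is `2π^{d/2}b^{d-1}/Γ(d/2)`. -/
def surfaceMeasure (d : ℕ) (b : ℝ) : Measure (EuclideanSpace ℝ (Fin d)) :=
  ((d : ℝ≥0∞) / ENNReal.ofReal b) •
    Measure.map (fun x : EuclideanSpace ℝ (Fin d) => (b / ‖x‖) • x)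
      (volume.restrict {x : EuclideanSpace ℝ (Fin d) | ‖x‖ ≤ b})


section LLT

open scoped FourierTransform

variable {V : Type*} [NormedAddCommGroup V] [InnerProductSpace ℝ V] [FiniteDimensional ℝ V]
  [MeasurableSpace V] [BorelSpace V]

/-- Existence of a nonnegative band-limited kernel. -/
lemma exists_kernel (V : Type*) [NormedAddCommGroup V] [InnerProductSpace ℝ V]
    [FiniteDimensional ℝ V] [MeasurableSpace V] [BorelSpace V] :
    ∃ (k : V → ℂ) (K : V → ℝ), Continuous k ∧ HasCompactSupport k ∧ Continuous K ∧
      (∀ y, 0 ≤ K y) ∧ 0 < K 0 ∧ (∀ y, (K y : ℂ) = 𝓕 k y) := by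
  let g : ContDiffBump (0 : V) := ⟨1, 2, by norm_num, by norm_num⟩
  let G : V → ℂ := fun v => (g v : ℂ)
  have hGc : Continuous G := Complex.continuous_ofReal.comp g.continuous
  have hGs : HasCompactSupport G := g.hasCompactSupport.comp_left (g := fun r : ℝ => (r : ℂ)) (by simp)
  have hGi : Integrable G := hGc.integrable_of_hasCompactSupport hGs
  have hreal : ∀ y, ((𝓕 G y).re : ℂ) = 𝓕 G y := by
    intro y
    rw [← Complex.conj_eq_iff_re]
    rw [Real.fourier_eq']
    rw [← integral_conj, ← integral_neg_eq_self]
    congr 1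
    ext v
    simp only [smul_eq_mul, map_mul, G, g.neg, Complex.conj_ofReal, ← Complex.exp_conj, inner_neg_left]
    congr 2
    simp
  have hcont : Continuous (𝓕 G) :=
    VectorFourier.fourierIntegral_continuous Real.continuous_fourierChar
      continuous_inner hGi
  refine ⟨convolution G G (ContinuousLinearMap.mul ℂ ℂ) volume, fun y => (𝓕 G y).re ^ 2, ?_, ?_, ?_, ?_, ?_, ?_⟩
  · exact hGs.continuous_convolution_right _ hGi.locallyIntegrable hGc
  · exact hGs.convolution _ hGs
  · exact (Complex.continuous_re.comp hcont).pow 2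
  · intro y; positivity
  · have : 𝓕 G 0 = ((∫ v, g v : ℝ) : ℂ) := by
      rw [Real.fourier_eq']; simp [G, integral_complex_ofReal]
    show 0 < (𝓕 G 0).re ^ 2
    rw [this]
    have := g.integral_pos (μ := (volume : Measure V))
    rw [Complex.ofReal_re]
    positivity
  · intro y
    rw [Real.fourier_mul_convolution_eq hGi hGi, ← hreal y]
    push_cast; simp [sq]

variable {Ω : Type*} [MeasurableSpace Ω] (ℙ : Measure Ω)

/-- Tilted characteristic function. -/
def QQ (Y : Ω → V) (x ζ : V) : ℂ :=
  ∫ ω, Complex.exp (((inner ℝ x (Y ω) : ℝ) : ℂ) + ((2 * Real.pi * inner ℝ ζ (Y ω) : ℝ) : ℂ) * Complex.I) ∂ℙ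

/-- Normalized residue. -/
def PP (X : Ω → V) (t : ℝ) (x ζ : V) : ℂ :=
  QQ ℙ (fun ω => X ω - t • x) x ζ *
    ((Real.exp (t * ‖x‖ ^ 2 / 2 + 2 * Real.pi ^ 2 * t * ‖ζ‖ ^ 2) : ℝ) : ℂ)

lemma norm_tilt (a c : ℝ) : ‖Complex.exp ((a : ℂ) + (c : ℂ) * Complex.I)‖ = Real.exp a := by
  rw [Complex.norm_exp]; simp

variable [IsProbabilityMeasure ℙ]

lemma measurable_QQ {Y : Ω → V} (hY : Measurable Y) (x : V) : Measurable (QQ ℙ Y x) := by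
  unfold QQ
  have : StronglyMeasurable (fun p : V × Ω => Complex.exp (((inner ℝ x (Y p.2) : ℝ) : ℂ) + ((2 * Real.pi * inner ℝ p.1 (Y p.2) : ℝ) : ℂ) * Complex.I)) := by
    apply Measurable.stronglyMeasurable
    fun_prop
  exact this.integral_prod_right.measurable

lemma J1 {Y : Ω → V} (hY : Measurable Y) (x ξ : V)
    (hint : Integrable (fun ω => Real.exp (inner ℝ x (Y ω))) ℙ)
    {k : V → ℂ} {K : V → ℝ} (hk : Continuous k) (hks : HasCompactSupport k)
    (hK : ∀ y, (K y : ℂ) = 𝓕 k y) :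
    ∫ ω, (K (Y ω) : ℂ) * Complex.exp (((inner ℝ x (Y ω) : ℝ) : ℂ) + ((2 * Real.pi * inner ℝ ξ (Y ω) : ℝ) : ℂ) * Complex.I) ∂ℙ
      = ∫ ζ, k (ξ - ζ) * QQ ℙ Y x ζ := by
  have hki : Integrable k := hk.integrable_of_hasCompactSupport hks
  have e1 : ∫ ζ, k (ξ - ζ) * QQ ℙ Y x ζ = ∫ θ, k θ * QQ ℙ Y x (ξ - θ) := by
    rw [← integral_sub_left_eq_self (fun θ => k θ * QQ ℙ Y x (ξ - θ)) volume ξ]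
    simp
  rw [e1]
  have e2 : ∀ θ, k θ * QQ ℙ Y x (ξ - θ) = ∫ ω, k θ * Complex.exp (((inner ℝ x (Y ω) : ℝ) : ℂ) + ((2 * Real.pi * inner ℝ (ξ - θ) (Y ω) : ℝ) : ℂ) * Complex.I) ∂ℙ := by
    intro θ; rw [QQ, integral_const_mul]
  simp_rw [e2]
  rw [integral_integral_swap]
  · congr 1
    ext ω
    rw [hK, Real.fourier_eq', ← integral_mul_const]
    congr 1
    ext θ
    rw [smul_eq_mul, mul_comm (Complex.exp _) (k θ), mul_assoc, ← Complex.exp_add]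
    congr 2
    rw [inner_sub_left]; push_cast; ring
  · have hp := Integrable.mul_prod hki.norm hint
    refine hp.mono ?_ ?_
    · apply Measurable.aestronglyMeasurable
      have := hk.measurable
      fun_prop
    · filter_upwards with p
      simp only [Function.uncurry, norm_mul, norm_tilt, Real.norm_eq_abs, Real.abs_exp, abs_norm, le_refl]

lemma J2 {Y : Ω → V} (hY : Measurable Y) (x : V)
    (hint : Integrable (fun ω => Real.exp (inner ℝ x (Y ω))) ℙ)
    {k : V → ℂ} {K : V → ℝ} (hk : Continuous k) (hks : HasCompactSupport k)
    (hKc : Continuous K) (hK : ∀ y, (K y : ℂ) = 𝓕 k y) (φ : SchwartzMap V ℂ) :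
    ∫ ω, φ (Y ω) * (K (Y ω) : ℂ) * ((Real.exp (inner ℝ x (Y ω)) : ℝ) : ℂ) ∂ℙ
      = ∫ ξ, (𝓕 φ) ξ * ∫ ζ, k (ξ - ζ) * QQ ℙ Y x ζ := by
  have hki : Integrable k := hk.integrable_of_hasCompactSupport hks
  obtain ⟨C, hC⟩ : ∃ C, ∀ y, ‖(K y : ℂ)‖ ≤ C := by
    refine ⟨∫ v, ‖k v‖, fun y => ?_⟩
    rw [hK]
    exact VectorFourier.norm_fourierIntegral_le_integral_norm _ _ _ _ _
  simp_rw [← J1 ℙ hY x _ hint hk hks hK, ← integral_const_mul]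
  rw [integral_integral_swap]
  · congr 1
    ext ω
    have hinv : φ (Y ω) = 𝓕⁻ (𝓕 (φ : V → ℂ)) (Y ω) := by
      rw [φ.continuous.fourierInv_fourier_eq φ.integrable]
      rw [← SchwartzMap.fourier_coe]
      exact (𝓕 φ).integrable
    rw [hinv, Real.fourierInv_eq', mul_assoc, ← integral_mul_const]
    congr 1
    ext ξ
    rw [smul_eq_mul, SchwartzMap.fourier_coe, Complex.exp_add]
    push_cast
    ring
  · have hp := Integrable.mul_prod ((𝓕 φ).integrable (μ := volume)).norm (hint.const_mul C)
    refine hp.mono ?_ ?_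
    · apply Measurable.aestronglyMeasurable
      have := hKc.measurable
      have := (𝓕 φ).continuous.measurable
      fun_prop
    · filter_upwards with p
      have hC0 : 0 ≤ C := (norm_nonneg _).trans (hC 0)
      simp only [Function.uncurry, norm_mul, norm_tilt, Real.norm_eq_abs, Real.abs_exp, abs_norm, abs_of_nonneg hC0]
      gcongr
      exact hC _

lemma J3 {X : Ω → V} {t : ℝ} (ht : 0 < t) (x ξ : V) (k : V → ℂ) :
    (((2 * Real.pi * t) ^ ((Module.finrank ℝ V : ℝ) / 2) * Real.exp (t * ‖x‖ ^ 2 / 2) : ℝ) : ℂ) *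
      ∫ ζ, k (ξ - ζ) * QQ ℙ (fun ω => X ω - t • x) x ζ =
    (((2 * Real.pi) ^ ((Module.finrank ℝ V : ℝ) / 2) : ℝ) : ℂ) *
      ∫ w, k (ξ - (√t)⁻¹ • w) * PP ℙ X t x ((√t)⁻¹ • w) * ((Real.exp (-(2 * Real.pi ^ 2) * ‖w‖ ^ 2) : ℝ) : ℂ) := by
  have hst : 0 < √t := Real.sqrt_pos.2 ht
  have e1 : ∀ w : V, k (ξ - (√t)⁻¹ • w) * PP ℙ X t x ((√t)⁻¹ • w) * ((Real.exp (-(2 * Real.pi ^ 2) * ‖w‖ ^ 2) : ℝ) : ℂ)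
      = (fun ζ => ((Real.exp (t * ‖x‖ ^ 2 / 2) : ℝ) : ℂ) * (k (ξ - ζ) * QQ ℙ (fun ω => X ω - t • x) x ζ)) ((√t)⁻¹ • w) := by
    intro w
    have : Real.exp (t * ‖x‖ ^ 2 / 2) = Real.exp (t * ‖x‖ ^ 2 / 2 + 2 * Real.pi ^ 2 * t * ‖(√t)⁻¹ • w‖ ^ 2) * Real.exp (-(2 * Real.pi ^ 2) * ‖w‖ ^ 2) := by
      rw [← Real.exp_add]
      congr 1
      rw [norm_smul, mul_pow, norm_inv, Real.norm_of_nonneg hst.le, inv_pow, Real.sq_sqrt ht.le]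
      field_simp
      ring
    simp only [PP]
    rw [this]
    push_cast
    ring
  rw [integral_congr_ae (Eventually.of_forall e1)]
  rw [Measure.integral_comp_smul volume (fun ζ => ((Real.exp (t * ‖x‖ ^ 2 / 2) : ℝ) : ℂ) * (k (ξ - ζ) * QQ ℙ (fun ω => X ω - t • x) x ζ)) (√t)⁻¹, integral_const_mul, inv_pow, inv_inv, abs_of_pos (by positivity)]
  rw [Real.mul_rpow (by positivity) ht.le]
  have : √t ^ Module.finrank ℝ V = t ^ ((Module.finrank ℝ V : ℝ) / 2) := by
    rw [Real.sqrt_eq_rpow, ← Real.rpow_natCast, ← Real.rpow_mul ht.le]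
    congr 1; ring
  rw [this, Complex.real_smul]
  push_cast
  ring

end LLT


section LLT2

open scoped FourierTransform

variable {V : Type*} [NormedAddCommGroup V] [InnerProductSpace ℝ V] [FiniteDimensional ℝ V]
  [MeasurableSpace V] [BorelSpace V]
  {Ω : Type*} [MeasurableSpace Ω] (ℙ : Measure Ω) [IsProbabilityMeasure ℙ]

/-- The normalized smoothed local density. -/
def GG (X : Ω → V) (t : ℝ) (f : V → ℝ) (x : V) : ℝ :=
  (2 * Real.pi * t) ^ ((Module.finrank ℝ V : ℝ) / 2) * Real.exp (t * ‖x‖ ^ 2 / 2) *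
    ∫ ω, f (X ω - t • x) * Real.exp (inner ℝ x (X ω - t • x)) ∂ℙ

/-- The normalized kernel expectation. -/
def JJ (X : Ω → V) (t : ℝ) (k : V → ℂ) (x ξ : V) : ℂ :=
  (((2 * Real.pi * t) ^ ((Module.finrank ℝ V : ℝ) / 2) * Real.exp (t * ‖x‖ ^ 2 / 2) : ℝ) : ℂ) *
      ∫ ζ, k (ξ - ζ) * QQ ℙ (fun ω => X ω - t • x) x ζ

lemma gauss_int : Integrable (fun w : V => Real.exp (-(2 * Real.pi ^ 2) * ‖w‖ ^ 2)) := by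
  have h := GaussianFourier.integrable_cexp_neg_mul_sq_norm_add (V := V) (b := ((2 * Real.pi ^ 2 : ℝ) : ℂ)) (by
    rw [Complex.ofReal_re]; positivity) 0 0
  have h2 := h.norm
  refine h2.congr (Eventually.of_forall fun w => ?_)
  simp only [Complex.norm_exp]
  congr 1
  rw [show (-((2 * Real.pi ^ 2 : ℝ) : ℂ) * (‖w‖ : ℂ) ^ 2 + 0 * ((inner ℝ (0 : V) w : ℝ) : ℂ)) = ((-(2 * Real.pi ^ 2) * ‖w‖ ^ 2 : ℝ) : ℂ) by push_cast; simp, Complex.ofReal_re]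

lemma gauss_const : (2 * Real.pi) ^ ((Module.finrank ℝ V : ℝ) / 2) *
    ∫ w : V, Real.exp (-(2 * Real.pi ^ 2) * ‖w‖ ^ 2) = 1 := by
  rw [GaussianFourier.integral_rexp_neg_mul_sq_norm (by positivity), ← Real.mul_rpow (by positivity) (by positivity)]
  have : 2 * Real.pi * (Real.pi / (2 * Real.pi ^ 2)) = 1 := by field_simp
  rw [this, Real.one_rpow]

lemma tilt_int {X : Ω → V} {t : ℝ} {x : V}
    (hint : Integrable (fun ω => Real.exp (inner ℝ x (X ω))) ℙ) :
    Integrable (fun ω => Real.exp (inner ℝ x (X ω - t • x))) ℙ := by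
  have := hint.const_mul (Real.exp (-(inner ℝ x (t • x))))
  refine this.congr (Eventually.of_forall fun ω => ?_)
  simp only [← Real.exp_add, inner_sub_right]
  congr 1; ring

lemma JJ_bound {X : ℕ → Ω → V} (hX : ∀ n, Measurable (X n)) {t : ℕ → ℝ}
    (ht : Tendsto t atTop atTop) {ρ : ℝ}
    (hint : ∀ n x, ‖x‖ ≤ ρ → Integrable (fun ω => Real.exp (inner ℝ x (X n ω))) ℙ)
    (hbd : ∀ R : ℝ, ∃ C : ℝ, ∀ᶠ n in atTop, ∀ x ζ, ‖x‖ ≤ ρ → ‖ζ‖ ≤ R →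
      ‖PP ℙ (X n) (t n) x ζ‖ ≤ C)
    {k : V → ℂ} {K : V → ℝ} (hk : Continuous k) (hks : HasCompactSupport k)
    (hK0 : ∀ y, 0 ≤ K y) (hK : ∀ y, (K y : ℂ) = 𝓕 k y) :
    ∃ C : ℝ, ∀ᶠ n in atTop, ∀ x ξ, ‖x‖ ≤ ρ → ‖JJ ℙ (X n) (t n) k x ξ‖ ≤ C := by
  obtain ⟨M, hM⟩ := hk.bounded_above_of_compact_support hks
  obtain ⟨R, hR⟩ := hks.isCompact.isBounded.exists_norm_le
  obtain ⟨C, hC⟩ := hbd (max R 0)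
  refine ⟨M * C, ?_⟩
  filter_upwards [hC, ht.eventually_gt_atTop 0] with n hCn htn x ξ hx
  have hY : Measurable (fun ω => X n ω - t n • x) := (hX n).sub_const _
  have hi := tilt_int ℙ (t := t n) (hint n x hx)
  -- reduce to `ξ = 0`
  have h0 : ‖JJ ℙ (X n) (t n) k x ξ‖ ≤ ‖JJ ℙ (X n) (t n) k x 0‖ := by
    rw [JJ, JJ, norm_mul, norm_mul, ← J1 ℙ hY x ξ hi hk hks hK, ← J1 ℙ hY x 0 hi hk hks hK]
    gcongr
    refine (norm_integral_le_integral_norm _).trans ?_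
    have e : (fun ω => (K (X n ω - t n • x) : ℂ) * Complex.exp (((inner ℝ x (X n ω - t n • x) : ℝ) : ℂ) + ((2 * Real.pi * inner ℝ (0 : V) (X n ω - t n • x) : ℝ) : ℂ) * Complex.I))
       = fun ω => ((K (X n ω - t n • x) * Real.exp (inner ℝ x (X n ω - t n • x)) : ℝ) : ℂ) := by
      ext ω; simp
    rw [e, integral_complex_ofReal, Complex.norm_real]
    refine le_trans (le_of_eq ?_) (le_abs_self _)
    congr 1
    ext ω
    rw [norm_mul, norm_tilt, Complex.norm_real, Real.norm_of_nonneg (hK0 _)]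
  refine h0.trans ?_
  rw [JJ, J3 ℙ htn x 0 k, norm_mul, Complex.norm_real, Real.norm_of_nonneg (by positivity)]
  have hC0 : 0 ≤ M := (norm_nonneg _).trans (hM 0)
  calc _ ≤ (2 * Real.pi) ^ ((Module.finrank ℝ V : ℝ) / 2) *
      ∫ w : V, (M * C) * Real.exp (-(2 * Real.pi ^ 2) * ‖w‖ ^ 2) := by
        gcongr
        refine norm_integral_le_of_norm_le (gauss_int.const_mul _) (Eventually.of_forall fun w => ?_)
        rw [norm_mul, norm_mul, Complex.norm_real, Real.norm_of_nonneg (Real.exp_pos _).le]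
        refine mul_le_mul_of_nonneg_right ?_ (Real.exp_pos _).le
        by_cases hz : k (0 - (√(t n))⁻¹ • w) = 0
        · rw [hz, norm_zero, zero_mul]
          refine mul_nonneg hC0 ((norm_nonneg _).trans (hCn x 0 hx (by simp)))
        · have := hR _ (subset_closure (Function.mem_support.2 hz))
          rw [zero_sub, norm_neg] at this
          gcongr
          · exact hM _
          · exact hCn x _ hx (this.trans (le_max_left _ _))
    _ = M * C := by
      rw [integral_const_mul, mul_left_comm, gauss_const, mul_one]

lemma JJ_tendsto {X : ℕ → Ω → V} (hX : ∀ n, Measurable (X n)) {t : ℕ → ℝ}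
    (ht : Tendsto t atTop atTop) {ρ : ℝ}
    (hbd : ∀ R : ℝ, ∃ C : ℝ, ∀ᶠ n in atTop, ∀ x ζ, ‖x‖ ≤ ρ → ‖ζ‖ ≤ R →
      ‖PP ℙ (X n) (t n) x ζ‖ ≤ C)
    {k : V → ℂ} (hk : Continuous k) (hks : HasCompactSupport k)
    {xs : ℕ → V} (hxs : ∀ᶠ n in atTop, ‖xs n‖ ≤ ρ) {l : ℂ}
    (hlim : ∀ ζs : ℕ → V, Tendsto ζs atTop (𝓝 0) →
      Tendsto (fun n => PP ℙ (X n) (t n) (xs n) (ζs n)) atTop (𝓝 l)) (ξ : V) :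
    Tendsto (fun n => JJ ℙ (X n) (t n) k (xs n) ξ) atTop (𝓝 (k ξ * l)) := by
  obtain ⟨M, hM⟩ := hk.bounded_above_of_compact_support hks
  obtain ⟨R, hR⟩ := hks.isCompact.isBounded.exists_norm_le
  obtain ⟨C, hC⟩ := hbd (‖ξ‖ + max R 0)
  have hM0 : 0 ≤ M := (norm_nonneg _).trans (hM 0)
  have key : Tendsto (fun n => (((2 * Real.pi) ^ ((Module.finrank ℝ V : ℝ) / 2) : ℝ) : ℂ) *
      ∫ w, k (ξ - (√(t n))⁻¹ • w) * PP ℙ (X n) (t n) (xs n) ((√(t n))⁻¹ • w) * ((Real.exp (-(2 * Real.pi ^ 2) * ‖w‖ ^ 2) : ℝ) : ℂ)) atTop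
      (𝓝 ((((2 * Real.pi) ^ ((Module.finrank ℝ V : ℝ) / 2) : ℝ) : ℂ) * ∫ w : V, k ξ * l * ((Real.exp (-(2 * Real.pi ^ 2) * ‖w‖ ^ 2) : ℝ) : ℂ))) := by
    refine Tendsto.const_mul _ ?_
    refine tendsto_integral_filter_of_dominated_convergence
      (fun w => M * C * Real.exp (-(2 * Real.pi ^ 2) * ‖w‖ ^ 2)) ?_ ?_ (gauss_int.const_mul _) ?_
    · refine Eventually.of_forall fun n => Measurable.aestronglyMeasurable ?_
      have h1 := hk.measurable
      have h2 : Measurable (PP ℙ (X n) (t n) (xs n)) := by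
        unfold PP
        have := measurable_QQ ℙ (((hX n).sub_const (t n • xs n))) (xs n)
        fun_prop
      fun_prop
    · filter_upwards [hC, hxs] with n hCn hxn
      refine Eventually.of_forall fun w => ?_
      rw [norm_mul, norm_mul, Complex.norm_real, Real.norm_of_nonneg (Real.exp_pos _).le]
      have hC0 : 0 ≤ C := (norm_nonneg _).trans (hCn (xs n) 0 hxn (by rw [norm_zero]; positivity))
      refine mul_le_mul_of_nonneg_right ?_ (Real.exp_pos _).le
      by_cases hz : k (ξ - (√(t n))⁻¹ • w) = 0
      · rw [hz, norm_zero, zero_mul]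
        positivity
      · have := hR _ (subset_closure (Function.mem_support.2 hz))
        gcongr
        · exact hM _
        · refine hCn _ _ hxn ?_
          have h3 : (√(t n))⁻¹ • w = ξ - (ξ - (√(t n))⁻¹ • w) := by abel
          rw [h3]
          refine (norm_sub_le _ _).trans ?_
          gcongr
          exact this.trans (le_max_left _ _)
    · refine Eventually.of_forall fun w => ?_
      have hz : Tendsto (fun n => (√(t n))⁻¹ • w) atTop (𝓝 0) := by
        have : Tendsto (fun n => (√(t n))⁻¹) atTop (𝓝 0) :=
          tendsto_inv_atTop_zero.comp (Real.tendsto_sqrt_atTop.comp ht)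
        simpa using this.smul_const w
      refine Tendsto.mul_const _ (Tendsto.mul ?_ (hlim _ hz))
      have h4 : Tendsto (fun n => ξ - (√(t n))⁻¹ • w) atTop (𝓝 ξ) := by
        simpa using tendsto_const_nhds.sub hz
      exact (hk.tendsto ξ).comp h4
  have e : (((2 * Real.pi) ^ ((Module.finrank ℝ V : ℝ) / 2) : ℝ) : ℂ) * ∫ w : V, k ξ * l * ((Real.exp (-(2 * Real.pi ^ 2) * ‖w‖ ^ 2) : ℝ) : ℂ) = k ξ * l := by
    rw [integral_const_mul, integral_complex_ofReal, mul_left_comm, ← Complex.ofReal_mul, gauss_const]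
    simp
  rw [e] at key
  refine key.congr' ?_
  filter_upwards [ht.eventually_gt_atTop 0] with n htn
  rw [JJ, J3 ℙ htn]

theorem llt {X : ℕ → Ω → V} (hX : ∀ n, Measurable (X n)) {t : ℕ → ℝ}
    (ht : Tendsto t atTop atTop) {ρ : ℝ}
    (hint : ∀ n x, ‖x‖ ≤ ρ → Integrable (fun ω => Real.exp (inner ℝ x (X n ω))) ℙ)
    (hbd : ∀ R : ℝ, ∃ C : ℝ, ∀ᶠ n in atTop, ∀ x ζ, ‖x‖ ≤ ρ → ‖ζ‖ ≤ R →
      ‖PP ℙ (X n) (t n) x ζ‖ ≤ C)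
    (L : V → ℂ)
    (hlim : ∀ x, ‖x‖ < ρ → ∀ xs ζs : ℕ → V, Tendsto xs atTop (𝓝 x) → Tendsto ζs atTop (𝓝 0) →
      Tendsto (fun n => PP ℙ (X n) (t n) (xs n) (ζs n)) atTop (𝓝 (L x)))
    (ε : ℝ) (hε : 0 < ε) :
    ∃ f : V → ℝ, Continuous f ∧ HasCompactSupport f ∧ (∀ y, 0 ≤ f y) ∧ (∀ y, f y ≠ 0 → ‖y‖ ≤ ε) ∧
      0 < ∫ y, f y ∧
      (∃ C : ℝ, ∀ᶠ n in atTop, ∀ x, ‖x‖ ≤ ρ → GG ℙ (X n) (t n) f x ≤ C) ∧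
      ∀ x, ‖x‖ < ρ → ∀ xs : ℕ → V, Tendsto xs atTop (𝓝 x) →
        Tendsto (fun n => (GG ℙ (X n) (t n) f (xs n) : ℂ)) atTop (𝓝 (L x * ((∫ y, f y : ℝ) : ℂ))) := by
  obtain ⟨k, K, hk, hks, hKc, hK0, hKpos, hK⟩ := exists_kernel V
  let g : ContDiffBump (0 : V) := ⟨ε / 2, ε, by positivity, by linarith⟩
  let φ0 : V → ℂ := fun v => (g v : ℂ)
  have hφs : HasCompactSupport φ0 := g.hasCompactSupport.comp_left (g := fun r : ℝ => (r : ℂ)) (by simp)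
  have hφd : ContDiff ℝ (↑(⊤ : ℕ∞)) φ0 := Complex.ofRealCLM.contDiff.comp g.contDiff
  let φ : SchwartzMap V ℂ := hφs.toSchwartzMap hφd
  have hφ : ∀ v, φ v = (g v : ℂ) := fun v => rfl
  have hGJ : ∀ n x, ‖x‖ ≤ ρ → (GG ℙ (X n) (t n) (fun v => g v * K v) x : ℂ) =
      ∫ ξ, (𝓕 φ) ξ * JJ ℙ (X n) (t n) k x ξ := by
    intro n x hx
    have hY : Measurable (fun ω => X n ω - t n • x) := (hX n).sub_const _
    have h := J2 ℙ hY x (tilt_int ℙ (hint n x hx)) hk hks hKc hK φ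
    have e : ∀ ξ, (𝓕 φ) ξ * JJ ℙ (X n) (t n) k x ξ = (((2 * Real.pi * t n) ^ ((Module.finrank ℝ V : ℝ) / 2) * Real.exp (t n * ‖x‖ ^ 2 / 2) : ℝ) : ℂ) * ((𝓕 φ) ξ * ∫ ζ, k (ξ - ζ) * QQ ℙ (fun ω => X n ω - t n • x) x ζ) := by
      intro ξ; rw [JJ]; ring
    simp_rw [e]
    rw [integral_const_mul, ← h, GG, Complex.ofReal_mul, ← integral_complex_ofReal]
    congr 2
    ext ω
    rw [hφ]; push_cast; ring
  obtain ⟨C, hC⟩ := JJ_bound ℙ hX ht hint hbd hk hks hK0 hK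
  have hFi : Integrable (fun ξ => (𝓕 φ) ξ) := (𝓕 φ).integrable
  refine ⟨fun v => g v * K v, g.continuous.mul hKc, g.hasCompactSupport.mul_right, fun y => mul_nonneg g.nonneg (hK0 y), ?_, ?_, ?_, ?_⟩
  · intro y hy
    have : g y ≠ 0 := left_ne_zero_of_mul hy
    have h2 : y ∈ Function.support g := this
    rw [g.support_eq, mem_ball_zero_iff] at h2
    exact h2.le
  · have hc : Continuous (fun v => g v * K v) := g.continuous.mul hKc
    refine hc.integral_pos_of_hasCompactSupport_nonneg_nonzero g.hasCompactSupport.mul_right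
      (fun y => mul_nonneg g.nonneg (hK0 y)) (x := 0) ?_
    have : g 0 = 1 := g.one_of_mem_closedBall (by simp; positivity)
    simp only [this, one_mul]
    exact hKpos.ne'
  · refine ⟨∫ ξ, ‖(𝓕 φ) ξ‖ * C, ?_⟩
    filter_upwards [hC] with n hCn x hx
    have h1 := hGJ n x hx
    have h2 : ‖(GG ℙ (X n) (t n) (fun v => g v * K v) x : ℂ)‖ ≤ ∫ ξ, ‖(𝓕 φ) ξ‖ * C := by
      rw [h1]
      refine norm_integral_le_of_norm_le (hFi.norm.mul_const _) (Eventually.of_forall fun ξ => ?_)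
      rw [norm_mul]
      gcongr
      exact hCn x ξ hx
    rw [Complex.norm_real] at h2
    exact (le_abs_self _).trans h2
  · intro x hx xs hxs
    have hev : ∀ᶠ n in atTop, ‖xs n‖ ≤ ρ :=
      (hxs.norm.eventually_lt_const hx).mono fun n hn => hn.le
    have hI : L x * ((∫ y, g y * K y : ℝ) : ℂ) = ∫ ξ, (𝓕 φ) ξ * (k ξ * L x) := by
      have h5 : ∫ ξ, (𝓕 (φ : V → ℂ)) ξ • k ξ = ∫ y, φ y • 𝓕 k y := by
        simpa using! (VectorFourier.integral_fourierIntegral_smul_eq_flip (L := innerₗ V)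
          (μ := volume) (ν := volume)
          Real.continuous_fourierChar continuous_inner (φ.integrable (μ := volume)) (hk.integrable_of_hasCompactSupport hks (μ := volume)))
      simp_rw [← mul_assoc]
      rw [integral_mul_const, mul_comm]
      congr 1
      simp only [smul_eq_mul] at h5
      rw [SchwartzMap.fourier_coe, h5, ← integral_complex_ofReal]
      congr 1
      ext y
      rw [hφ, ← hK]; push_cast; ring
    rw [hI]
    have : Tendsto (fun n => ∫ ξ, (𝓕 φ) ξ * JJ ℙ (X n) (t n) k (xs n) ξ) atTop (𝓝 (∫ ξ, (𝓕 φ) ξ * (k ξ * L x))) := by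
      refine tendsto_integral_filter_of_dominated_convergence (fun ξ => ‖(𝓕 φ) ξ‖ * C) ?_ ?_ (hFi.norm.mul_const _) ?_
      · refine Eventually.of_forall fun n => Measurable.aestronglyMeasurable ?_
        have h1 := (𝓕 φ).continuous.measurable
        have h2 : Measurable (JJ ℙ (X n) (t n) k (xs n)) := by
          unfold JJ
          refine Measurable.const_mul ?_ _
          have h3 : StronglyMeasurable (fun p : V × V => k (p.1 - p.2) * QQ ℙ (fun ω => X n ω - t n • xs n) (xs n) p.2) := by
            apply Measurable.stronglyMeasurable
            have := measurable_QQ ℙ (((hX n).sub_const (t n • xs n))) (xs n)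
            have := hk.measurable
            fun_prop
          exact h3.integral_prod_right.measurable
        fun_prop
      · filter_upwards [hC, hev] with n hCn hn
        refine Eventually.of_forall fun ξ => ?_
        rw [norm_mul]
        gcongr
        exact hCn _ ξ hn
      · refine Eventually.of_forall fun ξ => ?_
        exact (JJ_tendsto ℙ hX ht hbd hk hks hev (fun ζs hζ => hlim x hx xs ζs hxs hζ) ξ).const_mul _
    refine this.congr' ?_
    filter_upwards [hev] with n hn
    exact (hGJ n _ hn).symm

end LLT2


section Polar

variable {V : Type*} [NormedAddCommGroup V] [InnerProductSpace ℝ V] [FiniteDimensional ℝ V]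
  [MeasurableSpace V] [BorelSpace V] [Nontrivial V]

lemma lintegral_polar {F : V → ℝ≥0∞} (hF : Measurable F) :
    ∫⁻ x, F x = ∫⁻ s : Metric.sphere (0 : V) 1, (∫⁻ r in Set.Ioi (0 : ℝ),
      ENNReal.ofReal (r ^ (Module.finrank ℝ V - 1)) * F (r • (s : V))) ∂(volume : Measure V).toSphere := by
  have hc : Measurable (fun p : Metric.sphere (0 : V) 1 × Set.Ioi (0 : ℝ) => F ((p.2 : ℝ) • (p.1 : V))) := by
    fun_prop
  calc ∫⁻ x, F x = ∫⁻ x : ({(0 : V)}ᶜ : Set V), F x ∂((volume : Measure V).comap (↑)) := by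
        rw [lintegral_subtype_comap (measurableSet_singleton _).compl, restrict_compl_singleton]
    _ = ∫⁻ p, F ((p.2 : ℝ) • (p.1 : V)) ∂((volume : Measure V).toSphere.prod (.volumeIoiPow (Module.finrank ℝ V - 1))) := by
        rw [← (volume : Measure V).measurePreserving_homeomorphUnitSphereProd.lintegral_comp hc]
        refine lintegral_congr fun x => ?_
        congr 1
        have hx : (x : V) ≠ 0 := x.2
        simp [smul_smul, hx]
    _ = ∫⁻ s : Metric.sphere (0 : V) 1, (∫⁻ r, F ((r : ℝ) • (s : V)) ∂(Measure.volumeIoiPow (Module.finrank ℝ V - 1))) ∂(volume : Measure V).toSphere := by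
        rw [lintegral_prod _ hc.aemeasurable]
    _ = _ := by
        refine lintegral_congr fun s => ?_
        rw [Measure.volumeIoiPow, lintegral_withDensity_eq_lintegral_mul _ (by fun_prop) (by fun_prop)]
        simp only [Pi.mul_apply]
        rw [lintegral_subtype_comap measurableSet_Ioi (fun r : ℝ => ENNReal.ofReal (r ^ (Module.finrank ℝ V - 1)) * F (r • (s : V)))]

lemma lintegral_exp_Ici {b : ℝ} (hb : 0 < b) (c κ : ℝ) (hκ : 0 ≤ κ) :
    ∫⁻ u in Set.Ici c, ENNReal.ofReal (κ * Real.exp (-b * u)) = ENNReal.ofReal (κ * (Real.exp (-b * c) / b)) := by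
  rw [← setLIntegral_congr (Ioi_ae_eq_Ici (a := c))]
  have hi := (integrableOn_exp_mul_Ioi (neg_neg_of_pos hb) c).const_mul κ
  rw [← ofReal_integral_eq_lintegral_ofReal hi (Eventually.of_forall fun u => by positivity)]
  rw [integral_const_mul, integral_exp_mul_Ioi (neg_neg_of_pos hb), neg_div_neg_eq]

/-- The rescaled integrand in polar coordinates. -/
def gn (b ρ c t : ℝ) (G : V → ℝ) (T : Set V) (s : V) (u : ℝ) : ℝ≥0∞ :=
  T.indicator 1 s * (Set.Icc c (t * (ρ - b))).indicator 1 u *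
    ENNReal.ofReal ((b + u / t) ^ (Module.finrank ℝ V - 1) * Real.exp (-b * u - u ^ 2 / (2 * t)) * G ((b + u / t) • s))

lemma measurable_gn {b ρ c t : ℝ} {G : V → ℝ} (hG : Measurable G) {T : Set V} (hT : MeasurableSet T) :
    Measurable (fun p : Metric.sphere (0 : V) 1 × ℝ => gn b ρ c t G T (p.1 : V) p.2) := by
  unfold gn
  have h1 : Measurable (T.indicator (1 : V → ℝ≥0∞)) := measurable_one.indicator hT
  have h2 : Measurable ((Set.Icc c (t * (ρ - b))).indicator (1 : ℝ → ℝ≥0∞)) := measurable_one.indicator measurableSet_Icc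
  fun_prop

lemma polar_eq {b ρ c t : ℝ} (ht : 0 < t) (hc : 0 < t * b + c) {G : V → ℝ} (hG : Measurable G) {T : Set V} (hT : MeasurableSet T) :
    ∫⁻ y in {y : V | ‖y‖⁻¹ • y ∈ T ∧ t * b + c ≤ ‖y‖ ∧ ‖y‖ ≤ t * ρ},
      ENNReal.ofReal (Real.exp (-(‖y‖ ^ 2) / (2 * t)) * G (t⁻¹ • y)) =
    ENNReal.ofReal (t ^ (Module.finrank ℝ V - 1) * Real.exp (-(t * b ^ 2) / 2)) *
      ∫⁻ s : Metric.sphere (0 : V) 1, (∫⁻ u, gn b ρ c t G T (s : V) u) ∂(volume : Measure V).toSphere := by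
  have hA : MeasurableSet {y : V | ‖y‖⁻¹ • y ∈ T ∧ t * b + c ≤ ‖y‖ ∧ ‖y‖ ≤ t * ρ} := by
    refine MeasurableSet.inter ?_ (MeasurableSet.inter ?_ ?_)
    · exact (by fun_prop : Measurable (fun y : V => ‖y‖⁻¹ • y)) hT
    · exact measurableSet_le measurable_const measurable_norm
    · exact measurableSet_le measurable_norm measurable_const
  rw [← lintegral_indicator hA, lintegral_polar]
  swap
  · refine Measurable.indicator ?_ hA
    fun_prop
  rw [← lintegral_const_mul]
  swap
  · exact (measurable_gn hG hT).lintegral_prod_right'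
  refine lintegral_congr fun s => ?_
  have hs : ‖(s : V)‖ = 1 := by simpa using s.2
  rw [← lintegral_const_mul]
  swap
  · exact (measurable_gn hG hT).comp (measurable_prodMk_left (x := s))
  rw [← lintegral_indicator measurableSet_Ioi]
  rw [← lintegral_add_left_eq_self _ (t * b)]
  refine lintegral_congr fun u => ?_
  by_cases hu : 0 < t * b + u
  · rw [Set.indicator_of_mem (Set.mem_Ioi.2 hu)]
    unfold gn
    have hn : ‖(t * b + u) • (s : V)‖ = t * b + u := by rw [norm_smul, hs, mul_one, Real.norm_of_nonneg hu.le]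
    by_cases hsT : (s : V) ∈ T
    · by_cases huI : u ∈ Set.Icc c (t * (ρ - b))
      · rw [Set.indicator_of_mem, Set.indicator_of_mem hsT, Set.indicator_of_mem huI, hn]
        · simp only [Pi.one_apply, one_mul]
          rw [← ENNReal.ofReal_mul (by positivity), ← ENNReal.ofReal_mul (by positivity)]
          congr 1
          rw [smul_smul]
          have e1 : t⁻¹ * (t * b + u) = b + u / t := by field_simp
          have e2 : t * b + u = t * (b + u / t) := by field_simp
          have e3 : Real.exp (-(t * b + u) ^ 2 / (2 * t)) = Real.exp (-(t * b ^ 2) / 2) * Real.exp (-b * u - u ^ 2 / (2 * t)) := by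
            rw [← Real.exp_add]; congr 1; field_simp; ring
          rw [e1, e3]
          nth_rewrite 1 [e2]
          rw [mul_pow]
          ring
        · refine ⟨?_, ?_, ?_⟩
          · rw [hn, smul_smul, inv_mul_cancel₀ hu.ne', one_smul]; exact hsT
          · rw [hn]; linarith [huI.1]
          · rw [hn]; linarith [huI.2]
      · rw [Set.indicator_of_notMem, Set.indicator_of_notMem huI]
        · simp
        · rintro ⟨-, h1, h2⟩
          rw [hn] at h1 h2
          exact huI ⟨by linarith, by linarith⟩
    · rw [Set.indicator_of_notMem, Set.indicator_of_notMem hsT]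
      · simp
      · rintro ⟨h1, -⟩
        rw [hn, smul_smul, inv_mul_cancel₀ hu.ne', one_smul] at h1
        exact hsT h1
  · rw [Set.indicator_of_notMem (by simpa using hu)]
    unfold gn
    rw [Set.indicator_of_notMem (s := Set.Icc c (t * (ρ - b)))]
    · simp
    · rintro ⟨h, -⟩
      linarith

theorem lemmaM {t : ℕ → ℝ} (ht : Tendsto t atTop atTop) {b ρ : ℝ} (hb : 0 < b) (hρ : b < ρ) (c : ℝ)
    {G : ℕ → V → ℝ} (hGm : ∀ n, Measurable (G n)) {C : ℝ} (hC : ∀ᶠ n in atTop, ∀ x, ‖x‖ ≤ ρ → G n x ≤ C)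
    (L : V → ℝ) (hL0 : ∀ x, ‖x‖ = b → 0 ≤ L x)
    (hconv : ∀ x, ‖x‖ = b → ∀ xs : ℕ → V, Tendsto xs atTop (𝓝 x) →
      Tendsto (fun n => G n (xs n)) atTop (𝓝 (L x)))
    {T : Set V} (hT : MeasurableSet T) :
    Tendsto (fun n => (ENNReal.ofReal (t n ^ (Module.finrank ℝ V - 1) * Real.exp (-(t n * b ^ 2) / 2)))⁻¹ *
      ∫⁻ y in {y : V | ‖y‖⁻¹ • y ∈ T ∧ t n * b + c ≤ ‖y‖ ∧ ‖y‖ ≤ t n * ρ},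
        ENNReal.ofReal (Real.exp (-(‖y‖ ^ 2) / (2 * t n)) * G n ((t n)⁻¹ • y))) atTop
      (𝓝 (∫⁻ s : Metric.sphere (0 : V) 1, T.indicator 1 (s : V) *
        ENNReal.ofReal (b ^ (Module.finrank ℝ V - 1) * L (b • (s : V)) * (Real.exp (-b * c) / b)) ∂(volume : Measure V).toSphere)) := by
  have hcpos : ∀ᶠ n in atTop, 0 < t n * b + c := by
    filter_upwards [(ht.atTop_mul_const hb).eventually_gt_atTop (-c)] with n hn
    linarith
  have key : Tendsto (fun n => ∫⁻ s : Metric.sphere (0 : V) 1, (∫⁻ u, gn b ρ c (t n) (G n) T (s : V) u) ∂(volume : Measure V).toSphere) atTop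
      (𝓝 (∫⁻ s : Metric.sphere (0 : V) 1, T.indicator 1 (s : V) *
        ENNReal.ofReal (b ^ (Module.finrank ℝ V - 1) * L (b • (s : V)) * (Real.exp (-b * c) / b)) ∂(volume : Measure V).toSphere)) := by
    have hbound : ∀ᶠ n in atTop, ∀ (s : Metric.sphere (0 : V) 1) (u : ℝ), gn b ρ c (t n) (G n) T (s : V) u ≤
        (Set.Ici c).indicator (fun u => ENNReal.ofReal ((ρ ^ (Module.finrank ℝ V - 1) * max C 0) * Real.exp (-b * u))) u := by
      filter_upwards [hC, hcpos, ht.eventually_gt_atTop 0] with n hCn hcn htn s u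
      have hs : ‖(s : V)‖ = 1 := by simpa using s.2
      unfold gn
      by_cases huI : u ∈ Set.Icc c (t n * (ρ - b))
      · rw [Set.indicator_of_mem huI, Set.indicator_of_mem (Set.mem_Ici.2 huI.1)]
        have h1 : 0 ≤ b + u / t n := by
          have : b + u / t n = (t n * b + u) / t n := by field_simp
          rw [this]
          exact div_nonneg (by linarith [huI.1]) htn.le
        have h2 : b + u / t n ≤ ρ := by
          have : u / t n ≤ ρ - b := by rw [div_le_iff₀ htn]; linarith [huI.2]
          linarith
        have h3 : (T.indicator 1 (s : V) : ℝ≥0∞) ≤ 1 := Set.indicator_le_self' (by simp) _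
        calc _ ≤ 1 * 1 * ENNReal.ofReal ((b + u / t n) ^ (Module.finrank ℝ V - 1) * Real.exp (-b * u - u ^ 2 / (2 * t n)) * G n ((b + u / t n) • (s : V))) := by
              gcongr; rfl
          _ ≤ _ := by
              rw [one_mul, one_mul]
              apply ENNReal.ofReal_le_ofReal
              calc _ ≤ (b + u / t n) ^ (Module.finrank ℝ V - 1) * Real.exp (-b * u - u ^ 2 / (2 * t n)) * max C 0 := by
                    gcongr
                    refine (hCn _ ?_).trans (le_max_left _ _)
                    rw [norm_smul, hs, mul_one, Real.norm_of_nonneg h1]; exact h2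
                _ ≤ ρ ^ (Module.finrank ℝ V - 1) * Real.exp (-b * u) * max C 0 := by
                    have : (0 : ℝ) ≤ u ^ 2 / (2 * t n) := by positivity
                    have hρ0 : 0 < ρ := hb.trans hρ
                    gcongr
                    linarith
                _ = _ := by ring
      · rw [Set.indicator_of_notMem huI]; simp
    have hρC : 0 ≤ ρ ^ (Module.finrank ℝ V - 1) * max C 0 := by
      have : 0 < ρ := hb.trans hρ
      positivity
    have hBint : ∫⁻ u, (Set.Ici c).indicator (fun u => ENNReal.ofReal ((ρ ^ (Module.finrank ℝ V - 1) * max C 0) * Real.exp (-b * u))) u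
        = ENNReal.ofReal ((ρ ^ (Module.finrank ℝ V - 1) * max C 0) * (Real.exp (-b * c) / b)) := by
      rw [lintegral_indicator measurableSet_Ici, lintegral_exp_Ici hb _ _ hρC]
    refine tendsto_lintegral_filter_of_dominated_convergence
      (fun _ => ENNReal.ofReal ((ρ ^ (Module.finrank ℝ V - 1) * max C 0) * (Real.exp (-b * c) / b))) ?_ ?_ ?_ ?_
    · exact Eventually.of_forall fun n => (measurable_gn (hGm n) hT).lintegral_prod_right'
    · filter_upwards [hbound] with n hn
      refine Eventually.of_forall fun s => ?_
      rw [← hBint]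
      exact lintegral_mono (hn s)
    · rw [lintegral_const]
      exact ENNReal.mul_ne_top ENNReal.ofReal_ne_top (measure_ne_top _ _)
    · refine Eventually.of_forall fun s => ?_
      have hs : ‖(s : V)‖ = 1 := by simpa using s.2
      have hbs : ‖b • (s : V)‖ = b := by rw [norm_smul, hs, mul_one, Real.norm_of_nonneg hb.le]
      have e : T.indicator 1 (s : V) * ENNReal.ofReal (b ^ (Module.finrank ℝ V - 1) * L (b • (s : V)) * (Real.exp (-b * c) / b))
         = ∫⁻ u, T.indicator 1 (s : V) * (Set.Ici c).indicator (fun u => ENNReal.ofReal (b ^ (Module.finrank ℝ V - 1) * L (b • (s : V)) * Real.exp (-b * u))) u := by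
        rw [lintegral_const_mul, lintegral_indicator measurableSet_Ici, lintegral_exp_Ici hb]
        · exact mul_nonneg (by positivity) (hL0 _ hbs)
        · exact Measurable.indicator (by fun_prop) measurableSet_Ici
      rw [e]
      refine tendsto_lintegral_filter_of_dominated_convergence _ ?_ (hbound.mono fun n hn => Eventually.of_forall (hn s)) ?_ ?_
      · exact Eventually.of_forall fun n => (measurable_gn (hGm n) hT).comp (measurable_prodMk_left (x := s))
      · rw [hBint]; exact ENNReal.ofReal_ne_top
      · refine Eventually.of_forall fun u => ?_
        have hut : Tendsto (fun n => u / t n) atTop (𝓝 0) := ht.const_div_atTop u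
        have hbu : Tendsto (fun n => b + u / t n) atTop (𝓝 b) := by simpa using tendsto_const_nhds.add hut
        have hexp : Tendsto (fun n => Real.exp (-b * u - u ^ 2 / (2 * t n))) atTop (𝓝 (Real.exp (-b * u))) := by
          refine (Real.continuous_exp.tendsto _).comp ?_
          have : Tendsto (fun n => u ^ 2 / (2 * t n)) atTop (𝓝 0) := (ht.const_mul_atTop two_pos).const_div_atTop _
          simpa using tendsto_const_nhds.sub this
        by_cases huc : c ≤ u
        · have hev : ∀ᶠ n in atTop, u ∈ Set.Icc c (t n * (ρ - b)) := by
            filter_upwards [(ht.atTop_mul_const (sub_pos.2 hρ)).eventually_ge_atTop u] with n hn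
            exact ⟨huc, hn⟩
          rw [Set.indicator_of_mem (Set.mem_Ici.2 huc)]
          have h5 : Tendsto (fun n => T.indicator (1 : V → ℝ≥0∞) (s : V) * ENNReal.ofReal ((b + u / t n) ^ (Module.finrank ℝ V - 1) * Real.exp (-b * u - u ^ 2 / (2 * t n)) * G n ((b + u / t n) • (s : V)))) atTop
             (𝓝 (T.indicator 1 (s : V) * ENNReal.ofReal (b ^ (Module.finrank ℝ V - 1) * L (b • (s : V)) * Real.exp (-b * u)))) := by
            refine ENNReal.Tendsto.const_mul ?_ (Or.inr ?_)
            · refine ENNReal.tendsto_ofReal ?_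
              have := ((hbu.pow (Module.finrank ℝ V - 1)).mul hexp).mul (hconv _ hbs _ (hbu.smul_const (s : V)))
              refine this.trans (le_of_eq ?_)
              congr 1; ring
            · by_cases hsT : (s : V) ∈ T <;> simp [hsT]
          refine h5.congr' ?_
          filter_upwards [hev] with n hn
          unfold gn
          rw [Set.indicator_of_mem hn, Pi.one_apply, mul_one]
        · rw [Set.indicator_of_notMem (s := Set.Ici c) (by simpa using huc), mul_zero]
          refine tendsto_const_nhds.congr fun n => ?_
          unfold gn
          rw [Set.indicator_of_notMem (s := Set.Icc c (t n * (ρ - b)))]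
          · simp
          · rintro ⟨h, -⟩; exact huc h
  refine key.congr' ?_
  filter_upwards [hcpos, ht.eventually_gt_atTop 0] with n hcn htn
  rw [polar_eq htn hcn (hGm n) hT, ← mul_assoc, ENNReal.inv_mul_cancel, one_mul]
  · simp only [ne_eq, ENNReal.ofReal_eq_zero, not_le]; positivity
  · exact ENNReal.ofReal_ne_top

end Polar

section Surface

lemma surfaceMeasure_eq {d : ℕ} (hd : 0 < d) {b : ℝ} (hb : 0 < b) :
    surfaceMeasure d b = ENNReal.ofReal (b ^ (d - 1)) •
      Measure.map (fun s : Metric.sphere (0 : EuclideanSpace ℝ (Fin d)) 1 => b • (s : EuclideanSpace ℝ (Fin d)))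
        (volume : Measure (EuclideanSpace ℝ (Fin d))).toSphere := by
  haveI : Nonempty (Fin d) := ⟨⟨0, hd⟩⟩
  ext A hA
  have hm1 : Measurable (fun x : EuclideanSpace ℝ (Fin d) => (b / ‖x‖) • x) := by fun_prop
  have hm2 : Measurable (fun s : Metric.sphere (0 : EuclideanSpace ℝ (Fin d)) 1 => b • (s : EuclideanSpace ℝ (Fin d))) := by fun_prop
  unfold surfaceMeasure
  rw [Measure.smul_apply, Measure.smul_apply, Measure.map_apply hm1 hA, Measure.map_apply hm2 hA,
    Measure.restrict_apply (hm1 hA)]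
  have hc : MeasurableSet {x : EuclideanSpace ℝ (Fin d) | ‖x‖ ≤ b} := measurableSet_le measurable_norm measurable_const
  have hI := (hm1 hA).inter hc
  rw [← lintegral_indicator_one hI, lintegral_polar (measurable_one.indicator hI), finrank_euclideanSpace_fin]
  have hJ : ∫⁻ r in Set.Ioc (0 : ℝ) b, ENNReal.ofReal (r ^ (d - 1)) = ENNReal.ofReal (b ^ d / d) := by
    rw [← ofReal_integral_eq_lintegral_ofReal]
    · rw [← intervalIntegral.integral_of_le hb.le, integral_pow]
      congr 1
      have : d - 1 + 1 = d := by omega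
      rw [this]
      have h2 : ((d - 1 : ℕ) : ℝ) + 1 = d := by exact_mod_cast this
      rw [h2, zero_pow hd.ne', sub_zero]
    · exact ((continuous_pow _).integrableOn_Icc).mono_set Set.Ioc_subset_Icc_self
    · filter_upwards [ae_restrict_mem measurableSet_Ioc] with r hr
      exact pow_nonneg hr.1.le _
  have hin : ∀ s : Metric.sphere (0 : EuclideanSpace ℝ (Fin d)) 1,
      (∫⁻ r in Set.Ioi (0 : ℝ), ENNReal.ofReal (r ^ (d - 1)) *
        (((fun x : EuclideanSpace ℝ (Fin d) => (b / ‖x‖) • x) ⁻¹' A) ∩ {x | ‖x‖ ≤ b}).indicator 1 (r • (s : EuclideanSpace ℝ (Fin d)))) =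
      ENNReal.ofReal (b ^ d / d) *
        ((fun s : Metric.sphere (0 : EuclideanSpace ℝ (Fin d)) 1 => b • (s : EuclideanSpace ℝ (Fin d))) ⁻¹' A).indicator 1 s := by
    intro s
    have hs : ‖(s : EuclideanSpace ℝ (Fin d))‖ = 1 := by simp
    have hn : ∀ r : ℝ, 0 < r → ‖r • (s : EuclideanSpace ℝ (Fin d))‖ = r := fun r hr => by
      rw [norm_smul, hs, mul_one, Real.norm_of_nonneg hr.le]
    have e : ∀ r ∈ Set.Ioi (0 : ℝ), ENNReal.ofReal (r ^ (d - 1)) *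
        (((fun x : EuclideanSpace ℝ (Fin d) => (b / ‖x‖) • x) ⁻¹' A) ∩ {x | ‖x‖ ≤ b}).indicator 1 (r • (s : EuclideanSpace ℝ (Fin d)))
        = (Set.Iic b).indicator (fun r => ENNReal.ofReal (r ^ (d - 1))) r * ((fun s : Metric.sphere (0 : EuclideanSpace ℝ (Fin d)) 1 => b • (s : EuclideanSpace ℝ (Fin d))) ⁻¹' A).indicator 1 s := by
      intro r hr
      have hr' : (0 : ℝ) < r := hr
      have h1 : (b / r) • r • (s : EuclideanSpace ℝ (Fin d)) = b • (s : EuclideanSpace ℝ (Fin d)) := by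
        rw [smul_smul]; congr 1; field_simp
      by_cases h2 : r ≤ b <;> by_cases h3 : b • (s : EuclideanSpace ℝ (Fin d)) ∈ A <;>
        simp [Set.indicator, hn r hr', h1, h2, h3]
    rw [setLIntegral_congr_fun measurableSet_Ioi e, lintegral_mul_const]
    · congr 1
      rw [setLIntegral_indicator measurableSet_Iic, Set.inter_comm, Set.Ioi_inter_Iic, hJ]
    · exact Measurable.indicator (by fun_prop) measurableSet_Iic
  simp_rw [hin]
  rw [lintegral_const_mul _ (measurable_one.indicator (hm2 hA)), lintegral_indicator_one (hm2 hA), smul_eq_mul, smul_eq_mul, ← mul_assoc]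
  congr 1
  have hd' : (0 : ℝ) < d := by exact_mod_cast hd
  rw [← ENNReal.ofReal_natCast, ← ENNReal.ofReal_div_of_pos hb, ← ENNReal.ofReal_mul (by positivity)]
  congr 1
  have : b ^ d = b ^ (d - 1) * b := by rw [← pow_succ]; congr 1; omega
  rw [this]
  field_simp

end Surface

section Core

variable {V : Type*} [NormedAddCommGroup V] [InnerProductSpace ℝ V] [FiniteDimensional ℝ V]
  [MeasurableSpace V] [BorelSpace V]
variable {Ω : Type*} [MeasurableSpace Ω] {ℙ : Measure Ω} [IsProbabilityMeasure ℙ]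

lemma PP_zero (X : Ω → V) (t : ℝ) (x : V) :
    PP ℙ X t x 0 = (((∫ ω, Real.exp (inner ℝ x (X ω)) ∂ℙ) * Real.exp (-(t * ‖x‖ ^ 2 / 2)) : ℝ) : ℂ) := by
  unfold PP QQ
  have h : ∀ ω, Complex.exp (((inner ℝ x (X ω - t • x) : ℝ) : ℂ) + ((2 * Real.pi * inner ℝ (0 : V) (X ω - t • x) : ℝ) : ℂ) * Complex.I)
      = ((Real.exp (inner ℝ x (X ω)) * Real.exp (-(t * ‖x‖ ^ 2)) : ℝ) : ℂ) := by
    intro ω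
    rw [inner_zero_left, mul_zero, Complex.ofReal_zero, zero_mul, add_zero, ← Complex.ofReal_exp, ← Real.exp_add, inner_sub_right,
      inner_smul_right, real_inner_self_eq_norm_sq, sub_eq_add_neg]
  simp_rw [h]
  rw [integral_complex_ofReal, ← Complex.ofReal_mul, integral_mul_const, mul_assoc, ← Real.exp_add]
  congr 3
  simp
  ring

lemma exists_net {κ : ℝ} (hκ : 0 < κ) :
    ∃ F : Finset V, (∀ s ∈ F, ‖s‖ = 1) ∧ ∀ x : V, x ≠ 0 → ∃ s ∈ F, (1 - κ) * ‖x‖ ≤ inner ℝ s x := by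
  obtain ⟨F, hF, hc⟩ := (isCompact_sphere (0 : V) 1).elim_nhds_subcover (fun s => Metric.ball s κ)
    (fun s _ => Metric.ball_mem_nhds s hκ)
  refine ⟨F, fun s hs => by simpa using hF s hs, fun x hx => ?_⟩
  have hx' : ‖x‖ ≠ 0 := norm_ne_zero_iff.2 hx
  have hmem : ‖x‖⁻¹ • x ∈ Metric.sphere (0 : V) 1 := by
    simp [norm_smul, hx']
  have := hc hmem
  simp only [Set.mem_iUnion] at this
  obtain ⟨s, hsF, hs⟩ := this
  refine ⟨s, hsF, ?_⟩
  have hs1 : ‖s‖ = 1 := by simpa using hF s hsF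
  rw [Metric.mem_ball, dist_eq_norm] at hs
  have hxx : x = ‖x‖ • (‖x‖⁻¹ • x) := by rw [smul_smul, mul_inv_cancel₀ hx', one_smul]
  set w := ‖x‖⁻¹ • x with hw
  have hw1 : ‖w‖ = 1 := by simpa using hmem
  have h1 : inner ℝ s w = 1 - inner ℝ s (s - w) := by
    rw [inner_sub_right, real_inner_self_eq_norm_sq, hs1]; ring
  have h2 : inner ℝ s (s - w) ≤ κ := by
    calc _ ≤ ‖s‖ * ‖s - w‖ := real_inner_le_norm _ _
      _ ≤ κ := by rw [hs1, one_mul, norm_sub_rev]; exact hs.le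
  have h3 : inner ℝ s x = ‖x‖ * inner ℝ s w := by
    conv_lhs => rw [hxx]
    rw [inner_smul_right]
  rw [h3, h1, mul_comm]
  gcongr

theorem tail {X : ℕ → Ω → V} (hX : ∀ n, Measurable (X n)) {t : ℕ → ℝ}
    (ht : Tendsto t atTop atTop) {ρ b : ℝ} (hb : 0 < b) (hρ : b < ρ)
    (hint : ∀ n x, ‖x‖ ≤ ρ → Integrable (fun ω => Real.exp (inner ℝ x (X n ω))) ℙ)
    {C : ℝ} (hbd : ∀ᶠ n in atTop, ∀ x, ‖x‖ ≤ ρ → ‖PP ℙ (X n) (t n) x 0‖ ≤ C) :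
    ∃ M δ : ℝ, 0 ≤ M ∧ 0 < δ ∧ ∀ᶠ n in atTop,
      ℙ {ω | t n * ρ ≤ ‖X n ω‖} ≤ ENNReal.ofReal (M * Real.exp (-(t n * (b ^ 2 / 2 + δ)))) := by
  have hρ0 : 0 < ρ := hb.trans hρ
  have hsq : b ^ 2 < ρ ^ 2 := by nlinarith
  set κ : ℝ := (ρ ^ 2 - b ^ 2) / (4 * ρ ^ 2) with hκ
  have hκ0 : 0 < κ := div_pos (by linarith) (by positivity)
  obtain ⟨F, hF1, hF2⟩ := exists_net (V := V) hκ0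
  have hC0 : 0 ≤ C := by
    obtain ⟨n, hn⟩ := hbd.exists
    exact (norm_nonneg _).trans (hn 0 (by simpa using hρ0.le))
  refine ⟨F.card * C, (ρ ^ 2 - b ^ 2) / 4, by positivity, by linarith, ?_⟩
  filter_upwards [hbd, ht.eventually_gt_atTop 0] with n hn htn
  have hsub : {ω | t n * ρ ≤ ‖X n ω‖} ⊆ ⋃ s ∈ F, {ω | Real.exp (t n * ((1 - κ) * ρ ^ 2)) ≤ Real.exp (inner ℝ (ρ • s) (X n ω))} := by
    intro ω hω
    have hω' : t n * ρ ≤ ‖X n ω‖ := hω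
    have hpos : 0 < ‖X n ω‖ := lt_of_lt_of_le (by positivity) hω'
    obtain ⟨s, hs, hs2⟩ := hF2 (X n ω) (norm_pos_iff.1 hpos)
    simp only [Set.mem_iUnion]
    refine ⟨s, hs, ?_⟩
    rw [Set.mem_setOf_eq, Real.exp_le_exp, inner_smul_left]
    simp only [conj_trivial]
    have hκ1 : κ ≤ 1 := by
      rw [hκ, div_le_one (by positivity)]; nlinarith
    have : (1 - κ) * (t n * ρ) ≤ inner ℝ s (X n ω) := le_trans (by gcongr) hs2
    calc _ = ρ * ((1 - κ) * (t n * ρ)) := by ring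
      _ ≤ _ := by gcongr
  refine (measure_mono hsub).trans ((measure_biUnion_finset_le _ _).trans ?_)
  have hone : ∀ s ∈ F, ℙ {ω | Real.exp (t n * ((1 - κ) * ρ ^ 2)) ≤ Real.exp (inner ℝ (ρ • s) (X n ω))} ≤
      ENNReal.ofReal (C * Real.exp (-(t n * (b ^ 2 / 2 + (ρ ^ 2 - b ^ 2) / 4)))) := by
    intro s hs
    have hns : ‖ρ • s‖ = ρ := by rw [norm_smul, hF1 s hs, mul_one, Real.norm_of_nonneg hρ0.le]
    have hm := mul_meas_ge_le_integral_of_nonneg (μ := ℙ) (f := fun ω => Real.exp (inner ℝ (ρ • s) (X n ω)))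
      (Eventually.of_forall fun ω => (Real.exp_pos _).le) (hint n _ hns.le) (Real.exp (t n * ((1 - κ) * ρ ^ 2)))
    have hp := hn (ρ • s) hns.le
    rw [PP_zero, Complex.norm_real, Real.norm_of_nonneg (mul_nonneg (integral_nonneg fun ω => (Real.exp_pos _).le) (Real.exp_pos _).le), hns,
      Real.exp_neg, ← div_eq_mul_inv, div_le_iff₀ (Real.exp_pos _)] at hp
    rw [← ENNReal.ofReal_toReal (measure_ne_top ℙ {ω | Real.exp (t n * ((1 - κ) * ρ ^ 2)) ≤ Real.exp (inner ℝ (ρ • s) (X n ω))})]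
    apply ENNReal.ofReal_le_ofReal
    have h2 := hm.trans hp
    rw [mul_comm, ← le_div_iff₀ (Real.exp_pos _)] at h2
    refine h2.trans (le_of_eq ?_)
    rw [mul_div_assoc, ← Real.exp_sub]
    congr 2
    rw [hκ]; field_simp; ring
  refine (Finset.sum_le_sum hone).trans ?_
  rw [Finset.sum_const, nsmul_eq_mul, ← ENNReal.ofReal_natCast, ← ENNReal.ofReal_mul (by positivity), mul_assoc]

lemma measurable_GG {X : Ω → V} (hX : Measurable X) (t : ℝ) {f : V → ℝ} (hf : Continuous f) :
    Measurable (GG ℙ X t f) := by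
  unfold GG
  refine Measurable.mul (by fun_prop) ?_
  have : Measurable (fun p : V × Ω => f (X p.2 - t • p.1) * Real.exp (inner ℝ p.1 (X p.2 - t • p.1))) := by
    have := hf.measurable
    fun_prop
  exact this.stronglyMeasurable.integral_prod_right'.measurable

/-- The kernel. -/
def KK (t : ℝ) (f : V → ℝ) (x y : V) : ℝ≥0∞ :=
  ENNReal.ofReal (f (x - y) * Real.exp (inner ℝ (t⁻¹ • y) (x - y)))

lemma measurable_KK {X : Ω → V} (hX : Measurable X) (t : ℝ) {f : V → ℝ} (hf : Continuous f) :
    Measurable (fun p : V × Ω => KK t f (X p.2) p.1) := by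
  unfold KK
  have := hf.measurable
  fun_prop

lemma KK_int {X : Ω → V} (hX : Measurable X) {t : ℝ} (ht : 0 < t) {f : V → ℝ} (hf : Continuous f)
    (hfc : HasCompactSupport f) (hf0 : ∀ y, 0 ≤ f y) (y : V) :
    ENNReal.ofReal (Real.exp (-(‖y‖ ^ 2) / (2 * t)) * GG ℙ X t f (t⁻¹ • y)) =
      ENNReal.ofReal ((2 * Real.pi * t) ^ ((Module.finrank ℝ V : ℝ) / 2)) * ∫⁻ ω, KK t f (X ω) y ∂ℙ := by
  unfold GG KK
  have hty : t • t⁻¹ • y = y := by rw [smul_smul, mul_inv_cancel₀ ht.ne', one_smul]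
  rw [hty]
  have hi : Integrable (fun ω => f (X ω - y) * Real.exp (inner ℝ (t⁻¹ • y) (X ω - y))) ℙ := by
    have hg : Continuous (fun v : V => f v * Real.exp (inner ℝ (t⁻¹ • y) v)) := by fun_prop
    obtain ⟨B, hB⟩ := (hfc.mul_right (f' := fun v : V => Real.exp (inner ℝ (t⁻¹ • y) v))).exists_bound_of_continuous hg
    refine Integrable.of_bound (C := B) ?_ (Eventually.of_forall fun ω => hB (X ω - y))
    exact (hg.measurable.comp (hX.sub_const y)).aestronglyMeasurable
  rw [← ofReal_integral_eq_lintegral_ofReal hi (Eventually.of_forall fun ω => mul_nonneg (hf0 _) (Real.exp_pos _).le),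
    ← ENNReal.ofReal_mul (by positivity)]
  congr 1
  have : Real.exp (-(‖y‖ ^ 2) / (2 * t)) * Real.exp (t * ‖t⁻¹ • y‖ ^ 2 / 2) = 1 := by
    rw [← Real.exp_add, Real.exp_eq_one_iff, norm_smul, Real.norm_of_nonneg (inv_nonneg.2 ht.le)]
    field_simp
    ring
  calc _ = (Real.exp (-(‖y‖ ^ 2) / (2 * t)) * Real.exp (t * ‖t⁻¹ • y‖ ^ 2 / 2)) * (2 * Real.pi * t) ^ ((Module.finrank ℝ V : ℝ) / 2) *
      ∫ ω, f (X ω - y) * Real.exp (inner ℝ (t⁻¹ • y) (X ω - y)) ∂ℙ := by ring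
    _ = _ := by rw [this, one_mul]

lemma tonelli {X : Ω → V} (hX : Measurable X) {t : ℝ} (ht : 0 < t) {f : V → ℝ} (hf : Continuous f)
    (hfc : HasCompactSupport f) (hf0 : ∀ y, 0 ≤ f y) (A : Set V) :
    ∫⁻ y in A, ENNReal.ofReal (Real.exp (-(‖y‖ ^ 2) / (2 * t)) * GG ℙ X t f (t⁻¹ • y)) =
      ENNReal.ofReal ((2 * Real.pi * t) ^ ((Module.finrank ℝ V : ℝ) / 2)) * ∫⁻ ω, (∫⁻ y in A, KK t f (X ω) y) ∂ℙ := by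
  simp_rw [KK_int hX ht hf hfc hf0]
  rw [lintegral_const_mul _ (measurable_KK hX t hf).lintegral_prod_right']
  congr 1
  exact lintegral_lintegral_swap (measurable_KK hX t hf).aemeasurable

lemma f_int {f : V → ℝ} (hf : Continuous f) (hfc : HasCompactSupport f) (hf0 : ∀ y, 0 ≤ f y) (x : V) :
    ∫⁻ y, ENNReal.ofReal (f (x - y)) = ENNReal.ofReal (∫ y, f y) := by
  rw [lintegral_sub_left_eq_self (fun y => ENNReal.ofReal (f y)) x,
    ofReal_integral_eq_lintegral_ofReal (hf.integrable_of_hasCompactSupport hfc) (Eventually.of_forall hf0)]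

lemma inner_bd {t ρ ε : ℝ} (ht : 0 < t) {f : V → ℝ} (hfε : ∀ y, f y ≠ 0 → ‖y‖ ≤ ε) {x y : V} (hf : f (x - y) ≠ 0)
    (hy : ‖y‖ ≤ t * ρ) : |inner ℝ (t⁻¹ • y) (x - y)| ≤ ρ * ε := by
  have h1 : ‖t⁻¹ • y‖ ≤ ρ := by
    rw [norm_smul, Real.norm_of_nonneg (inv_nonneg.2 ht.le), inv_mul_le_iff₀ ht]; exact hy
  calc _ ≤ ‖t⁻¹ • y‖ * ‖x - y‖ := abs_real_inner_le_norm _ _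
    _ ≤ ρ * ε := mul_le_mul h1 (hfε _ hf) (norm_nonneg _) ((norm_nonneg _).trans h1)

lemma KK_lower {t ρ ε : ℝ} (ht : 0 < t) {f : V → ℝ} (hf : Continuous f)
    (hfc : HasCompactSupport f) (hf0 : ∀ y, 0 ≤ f y) (hfε : ∀ y, f y ≠ 0 → ‖y‖ ≤ ε)
    {A : Set V} (hAm : MeasurableSet A) (hA : ∀ y ∈ A, ‖y‖ ≤ t * ρ) {x : V} (hx : ∀ y, ‖x - y‖ ≤ ε → y ∈ A) :
    ENNReal.ofReal (Real.exp (-(ρ * ε)) * ∫ y, f y) ≤ ∫⁻ y in A, KK t f x y := by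
  rw [ENNReal.ofReal_mul (Real.exp_pos _).le, ← f_int hf hfc hf0 x, ← lintegral_const_mul _ (by have := hf.measurable; fun_prop),
    ← lintegral_indicator hAm]
  refine lintegral_mono fun y => ?_
  by_cases hfy : f (x - y) = 0
  · simp [hfy]
  · have hyA := hx y (hfε _ hfy)
    simp only [Set.indicator_of_mem hyA]
    unfold KK
    rw [← ENNReal.ofReal_mul (Real.exp_pos _).le, mul_comm]
    apply ENNReal.ofReal_le_ofReal
    have := (abs_le.1 (inner_bd ht hfε hfy (hA y hyA))).1
    have := hf0 (x - y)
    gcongr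

lemma KK_upper {t ρ ε : ℝ} (ht : 0 < t) {f : V → ℝ} (hf : Continuous f)
    (hfc : HasCompactSupport f) (hf0 : ∀ y, 0 ≤ f y) (hfε : ∀ y, f y ≠ 0 → ‖y‖ ≤ ε)
    {A : Set V} (hAm : MeasurableSet A) (hA : ∀ y ∈ A, ‖y‖ ≤ t * ρ) {E : Set V} {x : V} (hx : ∀ y ∈ A, ‖x - y‖ ≤ ε → x ∈ E) :
    ∫⁻ y in A, KK t f x y ≤ E.indicator (fun _ => ENNReal.ofReal (Real.exp (ρ * ε) * ∫ y, f y)) x := by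
  by_cases hxE : x ∈ E
  · rw [Set.indicator_of_mem hxE, ENNReal.ofReal_mul (Real.exp_pos _).le, ← f_int hf hfc hf0 x, ← lintegral_const_mul _ (by have := hf.measurable; fun_prop),
      ← lintegral_indicator hAm]
    refine lintegral_mono fun y => ?_
    by_cases hyA : y ∈ A
    · simp only [Set.indicator_of_mem hyA]
      unfold KK
      rw [← ENNReal.ofReal_mul (Real.exp_pos _).le, mul_comm (Real.exp _)]
      apply ENNReal.ofReal_le_ofReal
      by_cases hfy : f (x - y) = 0
      · simp [hfy]
      · have := (abs_le.1 (inner_bd ht hfε hfy (hA y hyA))).2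
        have := hf0 (x - y)
        gcongr
    · simp [Set.indicator_of_notMem hyA]
  · rw [Set.indicator_of_notMem hxE, nonpos_iff_eq_zero]
    rw [setLIntegral_congr_fun (g := fun _ => 0) hAm]
    · simp
    · intro y hy
      have : f (x - y) = 0 := by
        by_contra h
        exact hxE (hx y hy (hfε _ h))
      simp [KK, this]

lemma normalize_dist {x y : V} (hx : x ≠ 0) : ‖‖x‖⁻¹ • x - ‖y‖⁻¹ • y‖ ≤ 2 * ‖x - y‖ / ‖x‖ := by
  have hx' : 0 < ‖x‖ := norm_pos_iff.2 hx
  rw [le_div_iff₀ hx']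
  have e : ‖‖x‖⁻¹ • x - ‖y‖⁻¹ • y‖ * ‖x‖ = ‖x - (‖x‖ * ‖y‖⁻¹) • y‖ := by
    rw [← norm_norm x, mul_comm, ← norm_smul, norm_norm, smul_sub, smul_smul, smul_smul, mul_inv_cancel₀ hx'.ne', one_smul]
  rw [e]
  by_cases hy : y = 0
  · subst hy; simp; linarith
  have hy' : 0 < ‖y‖ := norm_pos_iff.2 hy
  calc ‖x - (‖x‖ * ‖y‖⁻¹) • y‖ = ‖(x - y) + (1 - ‖x‖ * ‖y‖⁻¹) • y‖ := by congr 1; rw [sub_smul, one_smul]; abel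
    _ ≤ ‖x - y‖ + ‖(1 - ‖x‖ * ‖y‖⁻¹) • y‖ := norm_add_le _ _
    _ = ‖x - y‖ + |‖y‖ - ‖x‖| := by
        congr 1
        rw [norm_smul, Real.norm_eq_abs, ← abs_of_pos hy', ← abs_mul, abs_of_pos hy']
        congr 1; field_simp
    _ ≤ ‖x - y‖ + ‖x - y‖ := by gcongr; rw [norm_sub_rev]; exact abs_norm_sub_norm_le _ _
    _ = _ := by ring

end Core

section Main

variable {V : Type*} [NormedAddCommGroup V] [InnerProductSpace ℝ V] [FiniteDimensional ℝ V]
  [MeasurableSpace V] [BorelSpace V] [Nontrivial V]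
variable {Ω : Type*} [MeasurableSpace Ω] {ℙ : Measure Ω} [IsProbabilityMeasure ℙ]

/-- spherical sector -/
def sector (b : ℝ) (S : Set V) : Set V := {x | ∃ s ∈ S, ∃ r : ℝ, b ≤ r ∧ x = r • s}

/-- normalisation -/
def NN (D : ℕ) (b t : ℝ) : ℝ≥0∞ :=
  ENNReal.ofReal (t ^ (D - 1) * Real.exp (-(t * b ^ 2) / 2)) * (ENNReal.ofReal ((2 * Real.pi * t) ^ ((D : ℝ) / 2)))⁻¹

/-- the annular domain -/
def AA (b ρ c t : ℝ) (T : Set V) : Set V := {y : V | ‖y‖⁻¹ • y ∈ T ∧ t * b + c ≤ ‖y‖ ∧ ‖y‖ ≤ t * ρ}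

lemma measurable_AA (b ρ c t : ℝ) {T : Set V} (hT : MeasurableSet T) : MeasurableSet (AA b ρ c t T) := by
  refine MeasurableSet.inter ?_ (MeasurableSet.inter ?_ ?_)
  · exact (by fun_prop : Measurable (fun y : V => ‖y‖⁻¹ • y)) hT
  · exact measurableSet_le measurable_const measurable_norm
  · exact measurableSet_le measurable_norm measurable_const

lemma sector_iff {b t : ℝ} (hb : 0 < b) (ht : 0 < t) {S : Set V} (hS : S ⊆ Metric.sphere (0 : V) 1) (x : V) :
    x ∈ t • sector b S ↔ t * b ≤ ‖x‖ ∧ ‖x‖⁻¹ • x ∈ S := by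
  constructor
  · rintro ⟨_, ⟨s, hs, r, hr, rfl⟩, rfl⟩
    have hs1 : ‖s‖ = 1 := by simpa using hS hs
    have hr0 : 0 < r := hb.trans_le hr
    have : ‖t • r • s‖ = t * r := by
      rw [norm_smul, norm_smul, hs1, mul_one, Real.norm_of_nonneg ht.le, Real.norm_of_nonneg hr0.le]
    simp only
    rw [this]
    refine ⟨by gcongr, ?_⟩
    rw [smul_smul, smul_smul]
    have : (t * r)⁻¹ * (t * r) = 1 := inv_mul_cancel₀ (by positivity)
    rw [mul_assoc, this, one_smul]; exact hs
  · rintro ⟨h1, h2⟩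
    have hx : 0 < ‖x‖ := lt_of_lt_of_le (by positivity) h1
    refine ⟨(‖x‖ / t) • (‖x‖⁻¹ • x), ⟨_, h2, _, ?_, rfl⟩, ?_⟩
    · rw [le_div_iff₀ ht]; linarith
    · simp only [smul_smul]
      have : t * (‖x‖ / t * ‖x‖⁻¹) = 1 := by field_simp
      rw [this, one_smul]

lemma geo_upper {b t ρ ρ' ε : ℝ} (hb : 0 < b) (ht : 0 < t) (hε : 0 < ε) (htb : 2 < t * b) (htρ : ε ≤ t * (ρ - ρ'))
    {S : Set V} (hS : S ⊆ Metric.sphere (0 : V) 1) {x : V} (hx : x ∈ t • sector b S) (hxρ : ‖x‖ ≤ t * ρ')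
    (y : V) (hxy : ‖x - y‖ ≤ ε) : y ∈ AA b ρ (-ε) t (Metric.thickening ε S) := by
  rw [sector_iff hb ht hS] at hx
  obtain ⟨h1, h2⟩ := hx
  have hx0 : 0 < ‖x‖ := lt_of_lt_of_le (by positivity) h1
  have h3 := norm_sub_norm_le x y
  have h4 := norm_sub_norm_le y x
  rw [norm_sub_rev] at h4
  refine ⟨?_, by linarith, by linarith⟩
  rw [Metric.mem_thickening_iff]
  refine ⟨_, h2, ?_⟩
  rw [dist_eq_norm, norm_sub_rev]
  refine (normalize_dist (norm_pos_iff.1 hx0)).trans_lt ?_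
  rw [div_lt_iff₀ hx0]
  nlinarith

lemma geo_lower {b t ρ ε : ℝ} (hb : 0 < b) (ht : 0 < t) (hε : 0 < ε) (htb : 2 < t * b)
    {S : Set V} (hS : S ⊆ Metric.sphere (0 : V) 1) {x : V}
    (y : V) (hy : y ∈ AA b ρ ε t (Metric.thickening ε (Metric.sphere (0 : V) 1 \ S))ᶜ) (hxy : ‖x - y‖ ≤ ε) : x ∈ t • sector b S := by
  rw [sector_iff hb ht hS]
  obtain ⟨h1, h2, -⟩ := hy
  have h4 := norm_sub_norm_le y x
  rw [norm_sub_rev] at h4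
  have h5 : t * b ≤ ‖x‖ := by linarith
  have hx0 : 0 < ‖x‖ := lt_of_lt_of_le (by positivity) h5
  refine ⟨h5, ?_⟩
  by_contra hc
  refine h1 ?_
  rw [Metric.mem_thickening_iff]
  refine ⟨‖x‖⁻¹ • x, ⟨?_, hc⟩, ?_⟩
  · simp [norm_smul, hx0.ne']
  · rw [dist_eq_norm, norm_sub_rev]
    refine (normalize_dist (norm_pos_iff.1 hx0)).trans_lt ?_
    rw [div_lt_iff₀ hx0]
    nlinarith

lemma NN_pos (D : ℕ) (b : ℝ) {t : ℝ} (ht : 0 < t) : NN D b t ≠ 0 := by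
  unfold NN
  refine mul_ne_zero ?_ (ENNReal.inv_ne_zero.2 ENNReal.ofReal_ne_top)
  simp only [ne_eq, ENNReal.ofReal_eq_zero, not_le]; positivity

lemma NN_top (D : ℕ) (b : ℝ) {t : ℝ} (ht : 0 < t) : NN D b t ≠ ⊤ := by
  unfold NN
  refine ENNReal.mul_ne_top ENNReal.ofReal_ne_top (ENNReal.inv_ne_top.2 ?_)
  simp only [ne_eq, ENNReal.ofReal_eq_zero, not_le]; positivity

lemma NN_eq (D : ℕ) (b : ℝ) {t : ℝ} (ht : 0 < t) :
    NN D b t = ENNReal.ofReal (t ^ (D - 1) * Real.exp (-(t * b ^ 2) / 2) / (2 * Real.pi * t) ^ ((D : ℝ) / 2)) := by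
  unfold NN
  rw [ENNReal.ofReal_div_of_pos (by positivity), ENNReal.div_eq_inv_mul, mul_comm]

lemma tail_lim {t : ℕ → ℝ} (ht : Tendsto t atTop atTop) (D : ℕ) (b M : ℝ) {δ : ℝ} (hδ : 0 < δ) (hM : 0 ≤ M)  :
    Tendsto (fun n => (NN D b (t n))⁻¹ * ENNReal.ofReal (M * Real.exp (-(t n * (b ^ 2 / 2 + δ))))) atTop (𝓝 0) := by
  have h0 := (tendsto_rpow_mul_exp_neg_mul_atTop_nhds_zero ((D : ℝ) / 2 - ((D - 1 : ℕ) : ℝ)) δ hδ).comp ht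
  have h1 := h0.const_mul (M * (2 * Real.pi) ^ ((D : ℝ) / 2))
  have h2 := ENNReal.tendsto_ofReal h1
  rw [mul_zero, ENNReal.ofReal_zero] at h2
  refine h2.congr' ?_
  filter_upwards [ht.eventually_gt_atTop 0] with n htn
  rw [NN_eq D b htn, ← ENNReal.ofReal_inv_of_pos (by positivity), ← ENNReal.ofReal_mul (by positivity)]
  congr 1
  simp only [Function.comp]
  rw [Real.mul_rpow (by positivity) htn.le, Real.rpow_sub htn, Real.rpow_natCast]
  have : Real.exp (-(t n * (b ^ 2 / 2 + δ))) = Real.exp (-(t n * b ^ 2) / 2) * Real.exp (-δ * t n) := by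
    rw [← Real.exp_add]; congr 1; ring
  rw [this]
  field_simp

/-- limiting weight -/
def hh (b : ℝ) (L : V → ℝ) (T : Set V) : ℝ≥0∞ :=
  ∫⁻ s : Metric.sphere (0 : V) 1, T.indicator 1 (s : V) *
        ENNReal.ofReal (b ^ (Module.finrank ℝ V - 1) * L (b • (s : V)) / b) ∂(volume : Measure V).toSphere

lemma hh_lim {b : ℝ} (hb : 0 < b) {L : V → ℝ} (hL : ContinuousOn L (Metric.sphere (0 : V) b))
    {S : Set V} (hSm : MeasurableSet S) (T : ℕ → Set V) (hT : ∀ k, MeasurableSet (T k))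
    (hlim : ∀ᵐ s : Metric.sphere (0 : V) 1 ∂(volume : Measure V).toSphere, ∀ᶠ k in atTop, (s : V) ∈ T k ↔ (s : V) ∈ S) :
    Tendsto (fun k => hh b L (T k)) atTop (𝓝 (hh b L S)) := by
  have hcont : Continuous (fun s : Metric.sphere (0 : V) 1 => L (b • (s : V))) := by
    refine hL.comp_continuous (by fun_prop) fun s => ?_
    simp [norm_smul, abs_of_pos hb]
  have hcont2 : Continuous (fun s : Metric.sphere (0 : V) 1 => b ^ (Module.finrank ℝ V - 1) * L (b • (s : V)) / b) :=
    (continuous_const.mul hcont).div_const b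
  obtain ⟨C, hC⟩ := (isCompact_range hcont2).bddAbove
  unfold hh
  refine tendsto_lintegral_filter_of_dominated_convergence (fun _ => ENNReal.ofReal C) ?_ ?_ ?_ ?_
  · refine Eventually.of_forall fun k => ?_
    have h1 : Measurable ((T k).indicator (1 : V → ℝ≥0∞)) := measurable_one.indicator (hT k)
    have := hcont2.measurable
    fun_prop
  · refine Eventually.of_forall fun k => Eventually.of_forall fun s => ?_
    have h3 : ((T k).indicator 1 (s : V) : ℝ≥0∞) ≤ 1 := Set.indicator_le_self' (by simp) _
    calc _ ≤ 1 * ENNReal.ofReal C := by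
          gcongr
          exact hC ⟨s, rfl⟩
      _ = _ := one_mul _
  · rw [lintegral_const]
    exact ENNReal.mul_ne_top ENNReal.ofReal_ne_top (measure_ne_top _ _)
  · filter_upwards [hlim] with s hs
    refine tendsto_const_nhds.congr' ?_
    filter_upwards [hs] with k hk
    by_cases h : (s : V) ∈ S
    · rw [Set.indicator_of_mem h, Set.indicator_of_mem (hk.2 h)]
    · rw [Set.indicator_of_notMem h, Set.indicator_of_notMem (fun h' => h (hk.1 h'))]

lemma not_thick {A : Set V} {s : V} (hs : s ∉ closure A) :
    ∀ᶠ k : ℕ in atTop, s ∉ Metric.thickening (1 / ((k : ℝ) + 1)) A := by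
  rw [Metric.mem_closure_iff] at hs
  push Not at hs
  obtain ⟨δ, hδ, h⟩ := hs
  filter_upwards [(tendsto_one_div_add_atTop_nhds_zero_nat (𝕜 := ℝ)).eventually (gt_mem_nhds hδ)] with k hk hmem
  rw [Metric.mem_thickening_iff] at hmem
  obtain ⟨z, hz, hz2⟩ := hmem
  linarith [h z hz]

lemma hh_pull (b : ℝ) (hb : 0 < b) (L : V → ℝ) (T : Set V) (m c : ℝ) (hm : 0 ≤ m) :
    ∫⁻ s : Metric.sphere (0 : V) 1, T.indicator 1 (s : V) *
        ENNReal.ofReal (b ^ (Module.finrank ℝ V - 1) * (L (b • (s : V)) * m) * (Real.exp (-b * c) / b)) ∂(volume : Measure V).toSphere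
    = ENNReal.ofReal (m * Real.exp (-b * c)) * hh b L T := by
  unfold hh
  rw [← lintegral_const_mul' _ _ ENNReal.ofReal_ne_top]
  refine lintegral_congr fun s => ?_
  rw [mul_left_comm (ENNReal.ofReal _), ← ENNReal.ofReal_mul (by positivity)]
  congr 2
  ring

theorem core {X : ℕ → Ω → V} (hX : ∀ n, Measurable (X n)) {t : ℕ → ℝ}
    (ht : Tendsto t atTop atTop) {ρ b : ℝ} (hb : 0 < b) (hρ : b < ρ)
    (hint : ∀ n x, ‖x‖ ≤ ρ → Integrable (fun ω => Real.exp (inner ℝ x (X n ω))) ℙ)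
    (hbd : ∀ R : ℝ, ∃ C : ℝ, ∀ᶠ n in atTop, ∀ x ζ, ‖x‖ ≤ ρ → ‖ζ‖ ≤ R →
      ‖PP ℙ (X n) (t n) x ζ‖ ≤ C)
    (L : V → ℝ) (hL0 : ∀ x, ‖x‖ = b → 0 ≤ L x) (hLc : ContinuousOn L (Metric.sphere (0 : V) b))
    (hlim : ∀ x, ‖x‖ < ρ → ∀ xs ζs : ℕ → V, Tendsto xs atTop (𝓝 x) → Tendsto ζs atTop (𝓝 0) →
      Tendsto (fun n => PP ℙ (X n) (t n) (xs n) (ζs n)) atTop (𝓝 ((L x : ℝ) : ℂ)))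
    {S : Set V} (hS : S ⊆ Metric.sphere (0 : V) 1) (hSm : MeasurableSet S)
    (hSb : ∀ᵐ s : Metric.sphere (0 : V) 1 ∂(volume : Measure V).toSphere, ¬ ((s : V) ∈ closure S ∧ (s : V) ∈ closure (Metric.sphere (0 : V) 1 \ S))) :
    Tendsto (fun n => (NN (Module.finrank ℝ V) b (t n))⁻¹ * ℙ {ω | X n ω ∈ t n • sector b S}) atTop (𝓝 (hh b L S)) := by
  set D := Module.finrank ℝ V with hD
  obtain ⟨ρ', hρ1, hρ2⟩ := exists_between hρ
  have hρ0 : 0 < ρ := hb.trans hρ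
  have ht0 := ht.eventually_gt_atTop 0
  have htb2 : ∀ᶠ n in atTop, 2 < t n * b := (ht.atTop_mul_const hb).eventually_gt_atTop 2
  -- tail
  obtain ⟨M, δ, hM, hδ, htail⟩ : ∃ M δ : ℝ, 0 ≤ M ∧ 0 < δ ∧ ∀ᶠ n in atTop,
      ℙ {ω | t n * ρ' ≤ ‖X n ω‖} ≤ ENNReal.ofReal (M * Real.exp (-(t n * (b ^ 2 / 2 + δ)))) := by
    obtain ⟨C, hC⟩ := hbd 0
    refine tail hX ht hb hρ1 (fun n x hx => hint n x (hx.trans hρ2.le)) (C := C) ?_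
    filter_upwards [hC] with n hn x hx
    exact hn x 0 (hx.trans hρ2.le) (by simp)
  have htl := tail_lim ht D b M hδ hM
  -- per-ε bounds
  have hε : ∀ ε : ℝ, 0 < ε →
      limsup (fun n => (NN D b (t n))⁻¹ * ℙ {ω | X n ω ∈ t n • sector b S}) atTop ≤
        ENNReal.ofReal (Real.exp ((ρ + b) * ε)) * hh b L (Metric.thickening ε S) ∧
      ENNReal.ofReal (Real.exp (-((ρ + b) * ε))) * hh b L (Metric.thickening ε (Metric.sphere (0 : V) 1 \ S))ᶜ ≤
      liminf (fun n => (NN D b (t n))⁻¹ * ℙ {ω | X n ω ∈ t n • sector b S}) atTop := by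
    intro ε hε
    obtain ⟨f, hf, hfc, hf0, hfε, hm, ⟨C, hC⟩, hconv⟩ := llt ℙ hX ht hint hbd (fun x => ((L x : ℝ) : ℂ)) hlim ε hε
    set m := ∫ y, f y with hmdef
    have hconv' : ∀ x, ‖x‖ = b → ∀ xs : ℕ → V, Tendsto xs atTop (𝓝 x) →
        Tendsto (fun n => GG ℙ (X n) (t n) f (xs n)) atTop (𝓝 (L x * m)) := by
      intro x hx xs hxs
      have := (Complex.continuous_re.tendsto _).comp (hconv x (hx.trans_lt hρ) xs hxs)
      rw [← Complex.ofReal_mul, Complex.ofReal_re] at this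
      exact this
    have hMl : ∀ (c : ℝ) (T : Set V), MeasurableSet T → Tendsto (fun n => (NN D b (t n))⁻¹ *
        ∫⁻ ω, (∫⁻ y in AA b ρ c (t n) T, KK (t n) f (X n ω) y) ∂ℙ) atTop (𝓝 (ENNReal.ofReal (m * Real.exp (-b * c)) * hh b L T)) := by
      intro c T hT
      have := lemmaM ht hb hρ c (G := fun n => GG ℙ (X n) (t n) f) (fun n => measurable_GG (hX n) _ hf) hC
        (fun x => L x * m) (fun x hx => mul_nonneg (hL0 x hx) hm.le) hconv' hT
      rw [hh_pull b hb L T m c hm.le] at this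
      refine this.congr' ?_
      filter_upwards [ht0] with n htn
      have e := tonelli (hX n) htn hf hfc hf0 (AA b ρ c (t n) T) (ℙ := ℙ)
      unfold AA at e ⊢
      rw [e, ← mul_assoc]
      congr 1
      unfold NN
      rw [ENNReal.mul_inv, inv_inv]
      · left; simp only [ne_eq, ENNReal.ofReal_eq_zero, not_le]; positivity
      · left; exact ENNReal.ofReal_ne_top
    constructor
    · have hT : MeasurableSet (Metric.thickening ε S) := Metric.isOpen_thickening.measurableSet
      have h1 := hMl (-ε) _ hT
      have hκ0 : ENNReal.ofReal (Real.exp (-(ρ * ε)) * m) ≠ 0 := by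
        simp only [ne_eq, ENNReal.ofReal_eq_zero, not_le]; positivity
      have h2 := (ENNReal.Tendsto.const_mul (a := (ENNReal.ofReal (Real.exp (-(ρ * ε)) * m))⁻¹) h1 (Or.inr (ENNReal.inv_ne_top.2 hκ0))).add htl
      rw [add_zero, ← mul_assoc] at h2
      have e : (ENNReal.ofReal (Real.exp (-(ρ * ε)) * m))⁻¹ * ENNReal.ofReal (m * Real.exp (-b * -ε)) = ENNReal.ofReal (Real.exp ((ρ + b) * ε)) := by
        rw [← ENNReal.ofReal_inv_of_pos (by positivity), ← ENNReal.ofReal_mul (by positivity)]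
        congr 1
        have : Real.exp ((ρ + b) * ε) = Real.exp (-b * -ε) * (Real.exp (-(ρ * ε)))⁻¹ := by
          rw [← Real.exp_neg, ← Real.exp_add]; congr 1; ring
        rw [this]
        field_simp
      rw [e] at h2
      rw [← h2.limsup_eq]
      refine limsup_le_limsup ?_
      have htρ : ∀ᶠ n in atTop, ε ≤ t n * (ρ - ρ') := (ht.atTop_mul_const (sub_pos.2 hρ2)).eventually_ge_atTop ε
      filter_upwards [ht0, htb2, htρ, htail] with n htn htb htρ htl
      have hP : ℙ {ω | X n ω ∈ t n • sector b S} ≤ (ENNReal.ofReal (Real.exp (-(ρ * ε)) * m))⁻¹ * (∫⁻ ω, (∫⁻ y in AA b ρ (-ε) (t n) (Metric.thickening ε S), KK (t n) f (X n ω) y) ∂ℙ) +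
          ENNReal.ofReal (M * Real.exp (-(t n * (b ^ 2 / 2 + δ)))) := by
        have hsub : {ω | X n ω ∈ t n • sector b S} ⊆
            {ω | ENNReal.ofReal (Real.exp (-(ρ * ε)) * m) ≤ ∫⁻ y in AA b ρ (-ε) (t n) (Metric.thickening ε S), KK (t n) f (X n ω) y} ∪ {ω | t n * ρ' ≤ ‖X n ω‖} := by
          intro ω hω
          by_cases h : t n * ρ' ≤ ‖X n ω‖
          · exact Or.inr h
          · left
            push Not at h
            exact KK_lower htn hf hfc hf0 hfε (measurable_AA _ _ _ _ hT) (fun y hy => hy.2.2)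
              (geo_upper hb htn hε htb htρ hS hω h.le)
        refine (measure_mono hsub).trans ((measure_union_le _ _).trans (add_le_add ?_ htl))
        rw [← ENNReal.div_eq_inv_mul]
        have hmeas : Measurable (fun ω => ∫⁻ y in AA b ρ (-ε) (t n) (Metric.thickening ε S), KK (t n) f (X n ω) y) :=
          ((measurable_KK (hX n) (t n) hf).comp measurable_swap).lintegral_prod_right'
        exact meas_ge_le_lintegral_div hmeas.aemeasurable hκ0 ENNReal.ofReal_ne_top
      calc _ ≤ (NN D b (t n))⁻¹ * ((ENNReal.ofReal (Real.exp (-(ρ * ε)) * m))⁻¹ * (∫⁻ ω, (∫⁻ y in AA b ρ (-ε) (t n) (Metric.thickening ε S), KK (t n) f (X n ω) y) ∂ℙ) +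
          ENNReal.ofReal (M * Real.exp (-(t n * (b ^ 2 / 2 + δ))))) := by gcongr
        _ = _ := by rw [mul_add, mul_left_comm]
    · have hT : MeasurableSet (Metric.thickening ε (Metric.sphere (0 : V) 1 \ S))ᶜ := Metric.isOpen_thickening.measurableSet.compl
      have h1 := hMl ε _ hT
      have hκ0 : ENNReal.ofReal (Real.exp (ρ * ε) * m) ≠ 0 := by
        simp only [ne_eq, ENNReal.ofReal_eq_zero, not_le]; positivity
      have h2 := (ENNReal.Tendsto.const_mul (a := (ENNReal.ofReal (Real.exp (ρ * ε) * m))⁻¹) h1 (Or.inr (ENNReal.inv_ne_top.2 hκ0)))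
      rw [← mul_assoc] at h2
      have e : (ENNReal.ofReal (Real.exp (ρ * ε) * m))⁻¹ * ENNReal.ofReal (m * Real.exp (-b * ε)) = ENNReal.ofReal (Real.exp (-((ρ + b) * ε))) := by
        rw [← ENNReal.ofReal_inv_of_pos (by positivity), ← ENNReal.ofReal_mul (by positivity)]
        congr 1
        have : Real.exp (-((ρ + b) * ε)) = Real.exp (-b * ε) * (Real.exp (ρ * ε))⁻¹ := by
          rw [← Real.exp_neg, ← Real.exp_add]; congr 1; ring
        rw [this]
        field_simp
      rw [e] at h2
      rw [← h2.liminf_eq]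
      refine liminf_le_liminf ?_
      filter_upwards [ht0, htb2] with n htn htb
      rw [mul_left_comm]
      gcongr
      rw [mul_comm, ← div_eq_mul_inv]
      refine ENNReal.div_le_of_le_mul ?_
      have hpre : MeasurableSet {ω | X n ω ∈ t n • sector b S} := by
        have : {ω | X n ω ∈ t n • sector b S} = X n ⁻¹' {x | t n * b ≤ ‖x‖ ∧ ‖x‖⁻¹ • x ∈ S} := by
          ext ω
          exact sector_iff hb htn hS _
        rw [this]
        refine hX n (MeasurableSet.inter (measurableSet_le measurable_const measurable_norm) ?_)
        exact (by fun_prop : Measurable (fun y : V => ‖y‖⁻¹ • y)) hSm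
      calc _ ≤ ∫⁻ ω, {ω | X n ω ∈ t n • sector b S}.indicator (fun _ => ENNReal.ofReal (Real.exp (ρ * ε) * m)) ω ∂ℙ := by
            refine lintegral_mono fun ω => ?_
            exact KK_upper (E := t n • sector b S) htn hf hfc hf0 hfε (measurable_AA _ _ _ _ hT) (fun y hy => hy.2.2)
              (fun y hy hxy => geo_lower hb htn hε htb hS y hy hxy)
        _ = _ := by rw [lintegral_indicator_const hpre, mul_comm]
  -- conclude
  have hε0 : Tendsto (fun k : ℕ => 1 / ((k : ℝ) + 1)) atTop (𝓝 0) := tendsto_one_div_add_atTop_nhds_zero_nat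
  have hεk : ∀ k : ℕ, (0 : ℝ) < 1 / ((k : ℝ) + 1) := fun k => by positivity
  have hU : Tendsto (fun k : ℕ => ENNReal.ofReal (Real.exp ((ρ + b) * (1 / ((k : ℝ) + 1)))) * hh b L (Metric.thickening (1 / ((k : ℝ) + 1)) S)) atTop (𝓝 (hh b L S)) := by
    have h1 : Tendsto (fun k : ℕ => ENNReal.ofReal (Real.exp ((ρ + b) * (1 / ((k : ℝ) + 1))))) atTop (𝓝 1) := by
      have := ENNReal.tendsto_ofReal ((Real.continuous_exp.tendsto _).comp (hε0.const_mul (ρ + b)))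
      simpa [Function.comp_def] using this
    have h2 : Tendsto (fun k : ℕ => hh b L (Metric.thickening (1 / ((k : ℝ) + 1)) S)) atTop (𝓝 (hh b L S)) := by
      refine hh_lim hb hLc hSm _ (fun k => Metric.isOpen_thickening.measurableSet) ?_
      filter_upwards [hSb] with s hs
      by_cases h : (s : V) ∈ S
      · exact Eventually.of_forall fun k => ⟨fun _ => h, fun _ => Metric.self_subset_thickening (hεk k) _ h⟩
      · have h3 : (s : V) ∉ closure S := fun h' => hs ⟨h', subset_closure ⟨s.2, h⟩⟩
        filter_upwards [not_thick h3] with k hk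
        exact ⟨fun h' => absurd h' hk, fun h' => absurd h' h⟩
    have := ENNReal.Tendsto.mul h1 (Or.inl one_ne_zero) h2 (Or.inr ENNReal.one_ne_top)
    rwa [one_mul] at this
  have hLo : Tendsto (fun k : ℕ => ENNReal.ofReal (Real.exp (-((ρ + b) * (1 / ((k : ℝ) + 1))))) * hh b L (Metric.thickening (1 / ((k : ℝ) + 1)) (Metric.sphere (0 : V) 1 \ S))ᶜ) atTop (𝓝 (hh b L S)) := by
    have h1 : Tendsto (fun k : ℕ => ENNReal.ofReal (Real.exp (-((ρ + b) * (1 / ((k : ℝ) + 1)))))) atTop (𝓝 1) := by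
      have := ENNReal.tendsto_ofReal ((Real.continuous_exp.tendsto _).comp (hε0.const_mul (ρ + b)).neg)
      simpa [Function.comp_def] using this
    have h2 : Tendsto (fun k : ℕ => hh b L (Metric.thickening (1 / ((k : ℝ) + 1)) (Metric.sphere (0 : V) 1 \ S))ᶜ) atTop (𝓝 (hh b L S)) := by
      refine hh_lim hb hLc hSm _ (fun k => Metric.isOpen_thickening.measurableSet.compl) ?_
      filter_upwards [hSb] with s hs
      by_cases h : (s : V) ∈ S
      · have h3 : (s : V) ∉ closure (Metric.sphere (0 : V) 1 \ S) := fun h' => hs ⟨subset_closure h, h'⟩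
        filter_upwards [not_thick h3] with k hk
        exact ⟨fun _ => h, fun _ => hk⟩
      · refine Eventually.of_forall fun k => ⟨fun h' => ?_, fun h' => absurd h' h⟩
        exact absurd (Metric.self_subset_thickening (hεk k) _ (show (s : V) ∈ Metric.sphere (0 : V) 1 \ S from ⟨s.2, h⟩)) h'
    have := ENNReal.Tendsto.mul h1 (Or.inl one_ne_zero) h2 (Or.inr ENNReal.one_ne_top)
    rwa [one_mul] at this
  refine tendsto_of_le_liminf_of_limsup_le ?_ ?_
  · exact le_of_tendsto' hLo fun k => (hε _ (hεk k)).2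
  · exact ge_of_tendsto' hU fun k => (hε _ (hεk k)).1

end Main

section Translate

variable {d : ℕ} {Ω : Type*} [MeasurableSpace Ω] {ℙ : Measure Ω} [IsProbabilityMeasure ℙ]

/-- The complex point `x + 2πiζ`. -/
def ZZ (x ζ : EuclideanSpace ℝ (Fin d)) : Fin d → ℂ := fun i => (x i : ℂ) + ((2 * Real.pi * ζ i : ℝ) : ℂ) * Complex.I

lemma inner_cast (x y : EuclideanSpace ℝ (Fin d)) : ((inner ℝ x y : ℝ) : ℂ) = ∑ i, (x i : ℂ) * (y i : ℂ) := by
  rw [PiLp.inner_apply]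
  push_cast
  refine Finset.sum_congr rfl fun i _ => ?_
  simp [mul_comm]

lemma ZZ_sum (x ζ y : EuclideanSpace ℝ (Fin d)) :
    ∑ i, ZZ x ζ i * (y i : ℂ) = ((inner ℝ x y : ℝ) : ℂ) + ((2 * Real.pi * inner ℝ ζ y : ℝ) : ℂ) * Complex.I := by
  push_cast
  rw [inner_cast, inner_cast, Finset.mul_sum, Finset.sum_mul, ← Finset.sum_add_distrib]
  refine Finset.sum_congr rfl fun i _ => ?_
  unfold ZZ
  push_cast
  ring

lemma ZZ_sq (x ζ : EuclideanSpace ℝ (Fin d)) :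
    ∑ i, ZZ x ζ i ^ 2 = ((‖x‖ ^ 2 - 4 * Real.pi ^ 2 * ‖ζ‖ ^ 2 : ℝ) : ℂ) + ((4 * Real.pi * inner ℝ ζ x : ℝ) : ℂ) * Complex.I := by
  rw [← real_inner_self_eq_norm_sq, ← real_inner_self_eq_norm_sq]
  push_cast
  rw [inner_cast, inner_cast, inner_cast, Finset.mul_sum, Finset.mul_sum, Finset.sum_mul, ← Finset.sum_sub_distrib, ← Finset.sum_add_distrib]
  refine Finset.sum_congr rfl fun i _ => ?_
  unfold ZZ
  push_cast
  linear_combination (4 * (Real.pi : ℂ) ^ 2 * (ζ i : ℂ) ^ 2) * Complex.I_sq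

lemma PP_eq (X : Ω → EuclideanSpace ℝ (Fin d)) (t : ℝ) (x ζ : EuclideanSpace ℝ (Fin d)) :
    PP ℙ X t x ζ = (∫ ω, Complex.exp (∑ i, ZZ x ζ i * (X ω i : ℂ)) ∂ℙ) *
        Complex.exp (-((t : ℝ) : ℂ) * (∑ i, ZZ x ζ i ^ 2) / 2) := by
  unfold PP QQ
  have h : ∀ ω, Complex.exp (((inner ℝ x (X ω - t • x) : ℝ) : ℂ) + ((2 * Real.pi * inner ℝ ζ (X ω - t • x) : ℝ) : ℂ) * Complex.I)
      = Complex.exp (∑ i, ZZ x ζ i * (X ω i : ℂ)) * Complex.exp (-(((t * ‖x‖ ^ 2 : ℝ) : ℂ) + ((2 * Real.pi * t * inner ℝ ζ x : ℝ) : ℂ) * Complex.I)) := by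
    intro ω
    rw [← Complex.exp_add, ZZ_sum, inner_sub_right, inner_sub_right, inner_smul_right, inner_smul_right, real_inner_self_eq_norm_sq]
    congr 1
    push_cast
    ring
  simp_rw [h]
  rw [integral_mul_const, mul_assoc, Complex.ofReal_exp, ← Complex.exp_add, ZZ_sq]
  congr 2
  push_cast
  ring

lemma ZZ_strip {a b' : Fin d → ℝ} {ρ : ℝ} (h : ∀ i, a i < -ρ ∧ ρ < b' i) {x : EuclideanSpace ℝ (Fin d)} (hx : ‖x‖ ≤ ρ)
    (ζ : EuclideanSpace ℝ (Fin d)) : ∀ i, a i < (ZZ x ζ i).re ∧ (ZZ x ζ i).re < b' i := by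
  intro i
  have h1 : (ZZ x ζ i).re = x i := by simp [ZZ]
  have h2 : |x i| ≤ ρ := (PiLp.norm_apply_le x i).trans hx
  rw [h1]
  rw [abs_le] at h2
  exact ⟨(h i).1.trans_le h2.1, h2.2.trans_lt (h i).2⟩

lemma continuous_ZZ : Continuous (fun p : EuclideanSpace ℝ (Fin d) × EuclideanSpace ℝ (Fin d) => ZZ p.1 p.2) := by
  unfold ZZ
  fun_prop

lemma exists_rho (a b' : Fin d → ℝ) {b : ℝ} (hb : 0 < b)
    (hsphere : ∀ s : EuclideanSpace ℝ (Fin d), ‖s‖ = b → ∀ i, a i < s i ∧ s i < b' i) :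
    ∃ ρ, b < ρ ∧ ∀ i, a i < -ρ ∧ ρ < b' i := by
  have h : ∀ᶠ r in 𝓝[>] b, ∀ i, a i < -r ∧ r < b' i := by
    rw [eventually_all]
    intro i
    refine nhdsWithin_le_nhds ?_
    have h1 := (hsphere (EuclideanSpace.single i (-b)) (by simp [abs_of_pos hb]) i).1
    have h2 := (hsphere (EuclideanSpace.single i b) (by simp [abs_of_pos hb]) i).2
    simp at h1 h2
    have c : Continuous (fun r : ℝ => -r) := continuous_neg
    exact (c.continuousAt.eventually (lt_mem_nhds h1)).and (gt_mem_nhds h2)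
  obtain ⟨ρ, h1, h2⟩ := (h.and self_mem_nhdsWithin).exists
  exact ⟨ρ, h2, h1⟩

end Translate

/-- Large deviations for a sequence converging mod-Gaussian in the Laplace
sense on a multi-strip with parameters `t_n I_d` and limit `ψ` (not vanishing on the real part
of the strip): for a spherical sector `B = S × [b, ∞)` with `S ⊆ S^{d-1}` measurable by
hypercubic facets (its relative boundary in the sphere has zero surface measure) and of
non-zero surface measure,
`P[X_n ∈ t_n B] = (t_n/2π)^{d/2} (1/(t_n b)) e^{−t_n b²/2} (∫_{S_b} ψ dμ_surface)(1+o(1))`. -/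
theorem modGaussian_largeDeviations_isotropic
    (d : ℕ) (hd : 0 < d)
    (Ω : Type*) [MeasurableSpace Ω] (ℙ : Measure Ω) [IsProbabilityMeasure ℙ]
    (X : ℕ → Ω → EuclideanSpace ℝ (Fin d)) (hX : ∀ n, Measurable (X n))
    (t : ℕ → ℝ) (ht : Tendsto t atTop atTop)
    (a b' : Fin d → ℝ)
    (ψ : (Fin d → ℂ) → ℂ)
    (hψcont : ContinuousOn ψ {z : Fin d → ℂ | ∀ i, a i < (z i).re ∧ (z i).re < b' i})
    (hψ1 : ψ 0 = 1)
    (hint : ∀ n, ∀ z : Fin d → ℂ, (∀ i, a i < (z i).re ∧ (z i).re < b' i) →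
      Integrable (fun ω => Complex.exp (∑ i, z i * (X n ω i : ℂ))) ℙ)
    (hmod : TendstoLocallyUniformlyOn
      (fun n z => (∫ ω, Complex.exp (∑ i, z i * (X n ω i : ℂ)) ∂ℙ) *
        Complex.exp (-((t n : ℝ) : ℂ) * (∑ i, z i ^ 2) / 2))
      ψ atTop {z : Fin d → ℂ | ∀ i, a i < (z i).re ∧ (z i).re < b' i})
    (hψne : ∀ x : Fin d → ℝ, (∀ i, a i < x i ∧ x i < b' i) → ψ (fun i => (x i : ℂ)) ≠ 0)
    (b : ℝ) (hb : 0 < b)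
    (hsphere : ∀ s : EuclideanSpace ℝ (Fin d), ‖s‖ = b → ∀ i, a i < s i ∧ s i < b' i)
    (S : Set (EuclideanSpace ℝ (Fin d)))
    (hS : S ⊆ Metric.sphere (0 : EuclideanSpace ℝ (Fin d)) 1)
    (hSmeas : MeasurableSet S)
    (hSfacets : surfaceMeasure d 1
      (closure S ∩ closure (Metric.sphere (0 : EuclideanSpace ℝ (Fin d)) 1 \ S)) = 0)
    (hSpos : surfaceMeasure d 1 S ≠ 0) :
    ∃ e : ℕ → ℂ, Tendsto e atTop (𝓝 0) ∧ ∀ᶠ n in atTop,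
      ((ℙ {ω | X n ω ∈
          t n • {x : EuclideanSpace ℝ (Fin d) | ∃ s ∈ S, ∃ r : ℝ, b ≤ r ∧ x = r • s}}).toReal
            : ℂ) =
        (((t n / (2 * Real.pi)) ^ ((d : ℝ) / 2) * (1 / (t n * b)) *
            Real.exp (-(t n * b ^ 2) / 2) : ℝ) : ℂ) *
          (∫ s in b • S, ψ (fun i => (s i : ℂ)) ∂surfaceMeasure d b) * (1 + e n) := by
  haveI : Nonempty (Fin d) := ⟨⟨0, hd⟩⟩
  obtain ⟨ρ, hρ, hstrip⟩ := exists_rho a b' hb hsphere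
  set DD : Set (Fin d → ℂ) := {z : Fin d → ℂ | ∀ i, a i < (z i).re ∧ (z i).re < b' i} with hDD
  have hDopen : IsOpen DD := by
    have : DD = ⋂ i, {z : Fin d → ℂ | a i < (z i).re ∧ (z i).re < b' i} := by
      ext z; simp [hDD]
    rw [this]
    refine isOpen_iInter_of_finite fun i => ?_
    have hc : Continuous (fun z : Fin d → ℂ => (z i).re) := by fun_prop
    exact (isOpen_lt continuous_const hc).inter (isOpen_lt hc continuous_const)
  have hmemD : ∀ x ζ : EuclideanSpace ℝ (Fin d), ‖x‖ ≤ ρ → ZZ x ζ ∈ DD := fun x ζ hx => ZZ_strip hstrip hx ζ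
  have hZ0 : ∀ x : EuclideanSpace ℝ (Fin d), ZZ x 0 = fun i => (x i : ℂ) := by
    intro x; ext i; simp [ZZ]
  -- integrability
  have hint' : ∀ n (x : EuclideanSpace ℝ (Fin d)), ‖x‖ ≤ ρ → Integrable (fun ω => Real.exp (inner ℝ x (X n ω))) ℙ := by
    intro n x hx
    have := (hint n _ (hmemD x 0 hx)).norm
    refine this.congr (Eventually.of_forall fun ω => ?_)
    simp only
    rw [ZZ_sum, norm_tilt]
  -- boundedness
  have hbd : ∀ R : ℝ, ∃ C : ℝ, ∀ᶠ n in atTop, ∀ x ζ, ‖x‖ ≤ ρ → ‖ζ‖ ≤ R → ‖PP ℙ (X n) (t n) x ζ‖ ≤ C := by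
    intro R
    set K : Set (Fin d → ℂ) := (fun p : EuclideanSpace ℝ (Fin d) × EuclideanSpace ℝ (Fin d) => ZZ p.1 p.2) ''
      (Metric.closedBall 0 ρ ×ˢ Metric.closedBall 0 R) with hK
    have hKc : IsCompact K := ((isCompact_closedBall _ _).prod (isCompact_closedBall _ _)).image continuous_ZZ
    have hKD : K ⊆ DD := by
      rintro _ ⟨⟨x, ζ⟩, ⟨hx, -⟩, rfl⟩
      exact hmemD x ζ (by simpa using hx)
    obtain ⟨C, hC⟩ := hKc.exists_bound_of_continuousOn (hψcont.mono hKD)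
    have hu := (tendstoLocallyUniformlyOn_iff_forall_isCompact hDopen).1 hmod K hKD hKc
    rw [Metric.tendstoUniformlyOn_iff] at hu
    refine ⟨C + 1, ?_⟩
    filter_upwards [hu 1 one_pos] with n hn x ζ hx hζ
    have hmem : ZZ x ζ ∈ K := ⟨(x, ζ), ⟨by simpa using hx, by simpa using hζ⟩, rfl⟩
    have h1 := hn _ hmem
    rw [← PP_eq, dist_eq_norm, norm_sub_rev] at h1
    have h2 := hC _ hmem
    calc _ = ‖(PP ℙ (X n) (t n) x ζ - ψ (ZZ x ζ)) + ψ (ZZ x ζ)‖ := by rw [sub_add_cancel]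
      _ ≤ _ := norm_add_le _ _
      _ ≤ C + 1 := by linarith
  -- limits
  have hlim0 : ∀ x : EuclideanSpace ℝ (Fin d), ‖x‖ < ρ → ∀ xs ζs : ℕ → EuclideanSpace ℝ (Fin d), Tendsto xs atTop (𝓝 x) → Tendsto ζs atTop (𝓝 0) →
      Tendsto (fun n => PP ℙ (X n) (t n) (xs n) (ζs n)) atTop (𝓝 (ψ (fun i => (x i : ℂ)))) := by
    intro x hx xs ζs hxs hζs
    simp_rw [PP_eq]
    rw [← hZ0]
    have hz : Tendsto (fun n => ZZ (xs n) (ζs n)) atTop (𝓝 (ZZ x 0)) :=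
      (continuous_ZZ.tendsto (x, 0)).comp (hxs.prodMk_nhds hζs)
    have hxD := hmemD x 0 hx.le
    refine hmod.tendsto_comp (hψcont _ hxD) hxD ?_
    exact tendsto_nhdsWithin_iff.2 ⟨hz, hz.eventually (hDopen.mem_nhds hxD)⟩
  set L : EuclideanSpace ℝ (Fin d) → ℝ := fun x => (ψ (fun i => (x i : ℂ))).re with hL
  have hreal : ∀ x : EuclideanSpace ℝ (Fin d), ‖x‖ < ρ → ψ (fun i => (x i : ℂ)) = ((L x : ℝ) : ℂ) ∧ 0 ≤ L x := by
    intro x hx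
    have h1 := hlim0 x hx (fun _ => x) (fun _ => 0) tendsto_const_nhds tendsto_const_nhds
    simp_rw [PP_zero] at h1
    have h2 := (Complex.continuous_re.tendsto _).comp h1
    have h3 := (Complex.continuous_im.tendsto _).comp h1
    simp only [Function.comp_def, Complex.ofReal_re, Complex.ofReal_im] at h2 h3
    have h4 := tendsto_nhds_unique h3 tendsto_const_nhds
    refine ⟨Complex.ext (by simp [hL]) (by simpa using h4), ?_⟩
    exact ge_of_tendsto' h2 fun n => mul_nonneg (integral_nonneg fun ω => (Real.exp_pos _).le) (Real.exp_pos _).le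
  have hLpos : ∀ x : EuclideanSpace ℝ (Fin d), ‖x‖ < ρ → 0 < L x := by
    intro x hx
    refine lt_of_le_of_ne (hreal x hx).2 fun h0 => ?_
    have h1 := (hreal x hx).1
    rw [← h0] at h1
    refine hψne (fun i => x i) ?_ (by simpa using h1)
    have := hmemD x 0 hx.le
    rw [hZ0] at this
    exact fun i => by simpa using this i
  have hLc : ContinuousOn L (Metric.sphere (0 : EuclideanSpace ℝ (Fin d)) b) := by
    refine Complex.continuous_re.comp_continuousOn ?_
    refine hψcont.comp (by fun_prop) ?_
    intro x hx
    have := hmemD x 0 (by simpa using (by simpa using hx : ‖x‖ = b).le.trans hρ.le)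
    rwa [hZ0] at this
  -- surface measure translation
  set σ := (volume : Measure (EuclideanSpace ℝ (Fin d))).toSphere with hσ
  set T : Set (Metric.sphere (0 : EuclideanSpace ℝ (Fin d)) 1) := {s | (s : EuclideanSpace ℝ (Fin d)) ∈ S} with hTdef
  have hTm : MeasurableSet T := measurable_subtype_coe hSmeas
  have hsurf1 : ∀ A : Set (EuclideanSpace ℝ (Fin d)), MeasurableSet A → surfaceMeasure d 1 A = σ {s | (s : EuclideanSpace ℝ (Fin d)) ∈ A} := by
    intro A hA
    rw [surfaceMeasure_eq hd one_pos, Measure.smul_apply, Measure.map_apply (by fun_prop) hA]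
    simp [Set.preimage, hσ]
  have hσT : σ T ≠ 0 := by rwa [← hsurf1 S hSmeas]
  have hSb : ∀ᵐ s : Metric.sphere (0 : EuclideanSpace ℝ (Fin d)) 1 ∂σ, ¬ ((s : EuclideanSpace ℝ (Fin d)) ∈ closure S ∧
      (s : EuclideanSpace ℝ (Fin d)) ∈ closure (Metric.sphere (0 : EuclideanSpace ℝ (Fin d)) 1 \ S)) := by
    rw [hsurf1 _ (isClosed_closure.inter isClosed_closure).measurableSet] at hSfacets
    rw [ae_iff]
    simpa using hSfacets
  have hcore := core (ℙ := ℙ) hX ht hb hρ hint' hbd L (fun x hx => (hreal x (hx.trans_lt hρ)).2) hLc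
    (fun x hx xs ζs h1 h2 => by
      have := hlim0 x hx xs ζs h1 h2
      rwa [(hreal x hx).1] at this) hS hSmeas hSb
  rw [finrank_euclideanSpace_fin] at hcore
  have hbs : ∀ s : Metric.sphere (0 : EuclideanSpace ℝ (Fin d)) 1, ‖b • (s : EuclideanSpace ℝ (Fin d))‖ = b := by
    intro s; simp [norm_smul, abs_of_pos hb]
  have hLcs : Continuous (fun s : Metric.sphere (0 : EuclideanSpace ℝ (Fin d)) 1 => L (b • (s : EuclideanSpace ℝ (Fin d)))) :=
    hLc.comp_continuous (by fun_prop) fun s => by simpa using hbs s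
  have hLi : Integrable (fun s : Metric.sphere (0 : EuclideanSpace ℝ (Fin d)) 1 => b ^ (d - 1) * L (b • (s : EuclideanSpace ℝ (Fin d))) / b) (σ.restrict T) := by
    have hc := (continuous_const (y := b ^ (d - 1))).mul hLcs |>.div_const b
    obtain ⟨C, hC⟩ := isCompact_univ.exists_bound_of_continuousOn hc.continuousOn
    exact Integrable.of_bound (C := C) hc.measurable.aestronglyMeasurable (Eventually.of_forall fun s => hC s trivial)
  have hLp : ∀ s : Metric.sphere (0 : EuclideanSpace ℝ (Fin d)) 1, 0 < b ^ (d - 1) * L (b • (s : EuclideanSpace ℝ (Fin d))) / b := by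
    intro s
    have := hLpos _ ((hbs s).trans_lt hρ)
    positivity
  set I : ℝ := ∫ s in T, b ^ (d - 1) * L (b • (s : EuclideanSpace ℝ (Fin d))) / b ∂σ with hI
  have hhh : hh b L S = ENNReal.ofReal I := by
    rw [hI, ofReal_integral_eq_lintegral_ofReal hLi (Eventually.of_forall fun s => (hLp s).le), ← lintegral_indicator hTm]
    unfold hh
    rw [finrank_euclideanSpace_fin]
    refine lintegral_congr fun s => ?_
    by_cases h : (s : EuclideanSpace ℝ (Fin d)) ∈ S
    · rw [Set.indicator_of_mem h, Set.indicator_of_mem (show s ∈ T from h), Pi.one_apply, one_mul]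
    · rw [Set.indicator_of_notMem h, Set.indicator_of_notMem (show s ∉ T from h), zero_mul]
  have hIpos : 0 < I := by
    rw [hI, integral_pos_iff_support_of_nonneg (fun s => (hLp s).le) hLi]
    have : Function.support (fun s : Metric.sphere (0 : EuclideanSpace ℝ (Fin d)) 1 => b ^ (d - 1) * L (b • (s : EuclideanSpace ℝ (Fin d))) / b) = Set.univ := by
      ext s
      exact ⟨fun _ => trivial, fun _ => (hLp s).ne'⟩
    rw [this, Measure.restrict_apply_univ]
    exact pos_iff_ne_zero.2 hσT
  have hψI : ∫ s in b • S, ψ (fun i => (s i : ℂ)) ∂surfaceMeasure d b = ((b * I : ℝ) : ℂ) := by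
    have hemb : MeasurableEmbedding (fun s : Metric.sphere (0 : EuclideanSpace ℝ (Fin d)) 1 => b • (s : EuclideanSpace ℝ (Fin d))) :=
      ((Homeomorph.smulOfNeZero b hb.ne').isClosedEmbedding.comp Metric.isClosed_sphere.isClosedEmbedding_subtypeVal).measurableEmbedding
    rw [surfaceMeasure_eq hd hb, Measure.restrict_smul, integral_smul_measure, hemb.setIntegral_map]
    have hpre : (fun s : Metric.sphere (0 : EuclideanSpace ℝ (Fin d)) 1 => b • (s : EuclideanSpace ℝ (Fin d))) ⁻¹' (b • S) = T := by
      ext s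
      simp [hTdef, Set.smul_mem_smul_set_iff₀ hb.ne']
    rw [hpre, ENNReal.toReal_ofReal (by positivity)]
    have h1 : ∀ s : Metric.sphere (0 : EuclideanSpace ℝ (Fin d)) 1, ψ (fun i => ((b • (s : EuclideanSpace ℝ (Fin d))) i : ℂ)) = ((L (b • (s : EuclideanSpace ℝ (Fin d))) : ℝ) : ℂ) :=
      fun s => (hreal _ ((hbs s).trans_lt hρ)).1
    simp_rw [h1]
    rw [integral_complex_ofReal, hI, Complex.real_smul, ← Complex.ofReal_mul]
    congr 1
    rw [integral_div, integral_const_mul]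
    field_simp
    rfl
  rw [hψI]
  -- conclude
  set p : ℕ → ℝ := fun n => (ℙ {ω | X n ω ∈ t n • {x : EuclideanSpace ℝ (Fin d) | ∃ s ∈ S, ∃ r : ℝ, b ≤ r ∧ x = r • s}}).toReal with hp
  set q : ℕ → ℝ := fun n => (t n / (2 * Real.pi)) ^ ((d : ℝ) / 2) * (1 / (t n * b)) * Real.exp (-(t n * b ^ 2) / 2) with hq
  have hq2 : ∀ᶠ n in atTop, 0 < q n ∧ NN d b (t n) = ENNReal.ofReal (q n * b) := by
    filter_upwards [ht.eventually_gt_atTop 0] with n htn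
    refine ⟨by simp only [hq]; positivity, ?_⟩
    rw [NN_eq d b htn]
    congr 1
    simp only [hq]
    have e1 : (t n / (2 * Real.pi)) ^ ((d : ℝ) / 2) = t n ^ d / (2 * Real.pi * t n) ^ ((d : ℝ) / 2) := by
      have : t n / (2 * Real.pi) = t n ^ 2 / (2 * Real.pi * t n) := by field_simp
      rw [this, Real.div_rpow (by positivity) (by positivity), ← Real.rpow_natCast (t n) 2, ← Real.rpow_mul htn.le, ← Real.rpow_natCast (t n) d]
      congr 2
      push_cast; ring
    have e2 : t n ^ d = t n ^ (d - 1) * t n := by rw [← pow_succ]; congr 1; omega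
    rw [e1, e2]
    field_simp
  have hlimr : Tendsto (fun n => p n / (q n * b)) atTop (𝓝 I) := by
    have := (ENNReal.tendsto_toReal (a := hh b L S) (by rw [hhh]; exact ENNReal.ofReal_ne_top)).comp hcore
    rw [hhh, ENNReal.toReal_ofReal hIpos.le] at this
    refine this.congr' ?_
    filter_upwards [hq2] with n hn
    simp only [Function.comp_def]
    rw [hn.2, ENNReal.toReal_mul, ENNReal.toReal_inv, ENNReal.toReal_ofReal (mul_pos hn.1 hb).le, div_eq_inv_mul]
    rfl
  refine ⟨fun n => ((p n / (q n * b) / I - 1 : ℝ) : ℂ), ?_, ?_⟩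
  · have h1 := (hlimr.div_const I).sub_const 1
    rw [div_self hIpos.ne', sub_self] at h1
    have := (Complex.continuous_ofReal.tendsto _).comp h1
    simpa [Function.comp_def] using this
  · filter_upwards [hq2] with n hn
    change ((p n : ℝ) : ℂ) = ((q n : ℝ) : ℂ) * ((b * I : ℝ) : ℂ) * (1 + _)
    rw [← Complex.ofReal_one, ← Complex.ofReal_add, ← Complex.ofReal_mul, ← Complex.ofReal_mul]
    congr 1
    have := hn.1
    field_simp
    ring

end
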